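/- Let r ≥ 0 be an integer, let k_0 =: q, k_1, …, k_r be positive integers, let a_0 =: a, a_1, …, a_r ∈ ℂ∖ℤ satisfy a_j − a_i ∉ {−1,−2,−3,…} for all 0 ≤ i < j ≤ r, and let x_0, x_1, …, x_r be roots of unity with (k_0, x_0) ≠ (1,1), (k_r, x_r) ≠ (1,1) and X := x_0 x_1 ⋯ x_r ≠ 1. Then X^{−1} · Li_{k_0,…,k_r}(x_0,…,x_r; a_0,…,a_r) + Σ_{j=0}^{r} (−1)^{k_0+⋯+k_j} (x_{j+1}⋯x_r)^{−1} Li_{k_{j+1},…,k_r}(x_{j+1},…,x_r; a_{j+1},…,a_r) · Li_{k_j,k_{j−1},…,k_0}(x_j^{−1},…,x_0^{−1}; 1−a_j, 1−a_{j−1},…, 1−a_0) + Σ_{j=0}^{q−1} Σ_{m_1+⋯+m_r=q−1−j, all m_l ≥ 0} B_{q−1−j}(k; m) · Lhat_{j+1}(X; a_0) · Li_{k_1+m_1,…,k_r+m_r}(x_1,…,x_r; 1−a_0+a_1,…,1−a_0+a_r) + Σ_{j=1}^{r} Σ_{i ≥ 0, m ≥ 0, i+m ≤ k_j−1} Σ_{(m_l)_{l≠j}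 nonnegative with Σ_{l≠j} m_l = m, and m_j := 0} (−1)^{k_0+⋯+k_{j−1}+m_{j+1}+⋯+m_r} C(q+k_j−m−i−2, q−1) (Π_{l≠j} C(m_l+k_l−1, k_l−1)) · Lhat_{i+1}(X; a_j) · Li_{k_{j+1}+m_{j+1},…,k_r+m_r}(x_{j+1},…,x_r; 1−a_j+a_{j+1},…,1−a_j+a_r) · Li_{k_{j−1}+m_{j−1},…,k_1+m_1, q+k_j−i−m−1}(x_{j−1}^{−1},…,x_1^{−1}, x_0^{−1}; 1+a_j−a_{j−1},…,1+a_j−a_1, 1+a_j−a_0) = 0. -/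

import Mathlib

open Filter Finset

/-- A complex number is a root of unity if some positive power of it equals 1. -/
def IsRootOfUnity (z : ℂ) : Prop := ∃ N : ℕ, 0 < N ∧ z ^ N = 1

open scoped Classical in
/-- Partial sum `Σ_{0<n_1<⋯<n_r≤N} Π_j x_j^{n_j} (n_j + b_j − 1)^{−k_j}` where the list `K`
consists of the triples `(k_j, x_j, b_j)`. -/
noncomputable def cmhzP (K : List (ℕ × ℂ × ℂ)) (N : ℕ) : ℂ :=
  ∑ n ∈ Finset.univ.filter (fun n : Fin K.length → Fin N => StrictMono n),
    ∏ j : Fin K.length,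
      (K.get j).2.1 ^ ((n j : ℕ) + 1) /
        ((((n j : ℕ) + 1 : ℕ) : ℂ) + (K.get j).2.2 - 1) ^ (K.get j).1

/-- Cyclotomic multiple Hurwitz zeta value: the limit of the partial sums `cmhzP`. -/
noncomputable def cmhz (K : List (ℕ × ℂ × ℂ)) : ℂ := limUnder atTop (cmhzP K)

/-- Cyclotomic multiple zeta value (all Hurwitz parameters equal to 1). -/
noncomputable def cmzv (K : List (ℕ × ℂ)) : ℂ := cmhz (K.map fun p => (p.1, p.2, 1))

/-- Cyclotomic multiple t-value (all Hurwitz parameters equal to 1/2). -/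
noncomputable def tval (K : List (ℕ × ℂ)) : ℂ := cmhz (K.map fun p => (p.1, p.2, (1 : ℂ)/2))

/-- Depth-one cyclotomic zeta value `Li_k(x)`. -/
noncomputable def li1 (k : ℕ) (x : ℂ) : ℂ := cmzv [(k, x)]

/-- Depth-one cyclotomic Hurwitz zeta value `Li_k(x; b)`. -/
noncomputable def lih1 (k : ℕ) (x b : ℂ) : ℂ := cmhz [(k, x, b)]

/-- Depth-one cyclotomic t-value `t_k(x)`. -/
noncomputable def tval1 (k : ℕ) (x : ℂ) : ℂ := tval [(k, x)]

/-- The generalized digamma-type series `φ(s; x) = Σ_{k≥0} x^k/(k+s)`. -/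
noncomputable def phiF (s x : ℂ) : ℂ :=
  limUnder atTop (fun N : ℕ => ∑ t ∈ Finset.range (N + 1), x ^ t / ((t : ℂ) + s))

/-- The extended trigonometric function `Φ(s; x) = φ(s; x) − φ(−s; x⁻¹) − 1/s`. -/
noncomputable def PhiF (s x : ℂ) : ℂ := phiF s x - phiF (-s) x⁻¹ - 1 / s

section
open Topology

/-- nested sum `Σ_{m<n_1<⋯<n_r≤N} Π f_j(n_j)` over the integers. -/
noncomputable def nestI : List (ℤ → ℂ) → ℤ → ℤ → ℂ
  | [], _, _ => 1
  | f :: L, m, N => ∑ n ∈ Finset.Ioc m N, f n * nestI L n N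

/-- the summand attached to a triple. -/
noncomputable def tf (c : ℕ × ℂ × ℂ) (n : ℤ) : ℂ := c.2.1 ^ n / ((n : ℂ) + c.2.2 - 1) ^ c.1

@[simp] lemma nestI_nil (m N : ℤ) : nestI [] m N = 1 := rfl

lemma nestI_cons (f : ℤ → ℂ) (L) (m N : ℤ) :
    nestI (f :: L) m N = ∑ n ∈ Finset.Ioc m N, f n * nestI L n N := rfl

lemma nestI_eq_zero {L : List (ℤ → ℂ)} (hL : L ≠ []) {m N : ℤ} (h : N ≤ m) : nestI L m N = 0 := by
  cases L with
  | nil => exact absurd rfl hL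
  | cons f L => rw [nestI_cons, Finset.Ioc_eq_empty (by omega)]; simp

lemma sum_Ioc_shift (g : ℤ → ℂ) (m N D : ℤ) :
    ∑ n ∈ Finset.Ioc m N, g n = ∑ n ∈ Finset.Ioc (m + D) (N + D), g (n - D) := by
  apply Finset.sum_bij' (fun n _ => n + D) (fun n _ => n - D) <;> simp <;> intros <;> (try constructor) <;> omega

lemma sum_Ioc_reflect (g : ℤ → ℂ) (m N D : ℤ) :
    ∑ n ∈ Finset.Ioc m N, g n = ∑ n ∈ Finset.Ioc (D - 1 - N) (D - 1 - m), g (D - n) := by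
  apply Finset.sum_bij' (fun n _ => D - n) (fun n _ => D - n) <;> simp <;> intros <;> (try constructor) <;> omega

lemma sum_Ioc_triangle (F : ℤ → ℤ → ℂ) (m N : ℤ) :
    ∑ n ∈ Finset.Ioc m N, ∑ p ∈ Finset.Ioc n N, F n p =
      ∑ p ∈ Finset.Ioc m N, ∑ n ∈ Finset.Ioc m (p - 1), F n p := by
  rw [Finset.sum_sigma', Finset.sum_sigma']
  apply Finset.sum_bij' (fun z _ => ⟨z.2, z.1⟩) (fun z _ => ⟨z.2, z.1⟩) <;> simp <;> intros <;> omega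

lemma nestI_snoc (L : List (ℤ → ℂ)) (f : ℤ → ℂ) (m N : ℤ) :
    nestI (L ++ [f]) m N = ∑ n ∈ Finset.Ioc m N, f n * nestI L m (n - 1) := by
  induction L generalizing m with
  | nil => simp [nestI_cons]
  | cons g L ih =>
    simp only [List.cons_append, nestI_cons, ih, Finset.mul_sum]
    rw [sum_Ioc_triangle]
    refine Finset.sum_congr rfl fun p _ => Finset.sum_congr rfl fun n _ => by ring

lemma nestI_shift (L : List (ℤ → ℂ)) (m N D : ℤ) :
    nestI L m N = nestI (L.map fun f n => f (n - D)) (m + D) (N + D) := by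
  induction L generalizing m with
  | nil => simp
  | cons f L ih =>
    simp only [List.map_cons, nestI_cons]
    rw [sum_Ioc_shift _ m N D]
    refine Finset.sum_congr rfl fun n _ => ?_
    rw [ih]; simp

lemma nestI_reflect (L : List (ℤ → ℂ)) (m N D : ℤ) :
    nestI L m N = nestI (L.map fun f n => f (D - n)).reverse (D - 1 - N) (D - 1 - m) := by
  induction L generalizing m with
  | nil => simp
  | cons f L ih =>
    simp only [List.map_cons, nestI_cons, List.reverse_cons, nestI_snoc]
    rw [sum_Ioc_reflect _ m N D]
    refine Finset.sum_congr rfl fun n _ => ?_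
    rw [ih]; congr 2; ring

lemma nestI_const {α : Type*} (K : List α) (u : α → ℂ) (g : α → ℤ → ℂ) (m N : ℤ) :
    nestI (K.map fun c n => u c * g c n) m N = (K.map u).prod * nestI (K.map g) m N := by
  induction K generalizing m with
  | nil => simp
  | cons c K ih =>
    simp only [List.map_cons, nestI_cons, List.prod_cons, ih, Finset.mul_sum]
    refine Finset.sum_congr rfl fun n _ => by ring

lemma sum_Ioc_split (g : ℤ → ℂ) {m : ℤ} (hm : m ≤ 0) (N : ℤ) :
    ∑ n ∈ Finset.Ioc m N, g n = ∑ n ∈ Finset.Ioc m (min 0 N), g n + ∑ n ∈ Finset.Ioc 0 N, g n := by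
  rw [← Finset.sum_union]
  · congr 1; ext n; simp; omega
  · rw [Finset.disjoint_left]; intro n; simp; omega

lemma nestI_split (K : List (ℤ → ℂ)) {m : ℤ} (hm : m ≤ 0) (N : ℤ) :
    nestI K m N = ∑ i ∈ Finset.range (K.length + 1),
      nestI (K.take i) m (min 0 N) * nestI (K.drop i) 0 N := by
  induction K generalizing m with
  | nil => simp
  | cons f K ih =>
    rw [List.length_cons, Finset.sum_range_succ']
    simp only [List.take_succ_cons, List.drop_succ_cons, List.take_zero, List.drop_zero, nestI_nil, one_mul]
    rw [nestI_cons, sum_Ioc_split _ hm]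
    congr 1
    simp only [nestI_cons, Finset.sum_mul]
    rw [Finset.sum_comm]
    refine Finset.sum_congr rfl fun n hn => ?_
    rw [Finset.mem_Ioc] at hn
    rw [ih (by omega), Finset.mul_sum]
    refine Finset.sum_congr rfl fun i _ => by ring

lemma strictMono_cons_iff {s N : ℕ} (a : Fin N) (f : Fin s → Fin N) :
    StrictMono (Fin.cons a f : Fin (s+1) → Fin N) ↔ (∀ i, a < f i) ∧ StrictMono f := by
  constructor
  · intro h
    refine ⟨fun i => ?_, fun i j hij => ?_⟩
    · have := h (Fin.succ_pos i); simpa using this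
    · have := h (Fin.succ_lt_succ_iff.2 hij); simpa using this
  · rintro ⟨h1, h2⟩ i j hij
    induction i using Fin.cases with
    | zero =>
      induction j using Fin.cases with
      | zero => exact absurd hij (lt_irrefl _)
      | succ j => simpa using h1 j
    | succ i =>
      induction j using Fin.cases with
      | zero => simp at hij
      | succ j => simpa using h2 (Fin.succ_lt_succ_iff.1 hij)

lemma sum_fin_Ioc (g : ℤ → ℂ) (m N : ℕ) :
    ∑ n : Fin N, (if m ≤ n.val then g ((n.val : ℤ) + 1) else 0) = ∑ n ∈ Finset.Ioc (m : ℤ) N, g n := by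
  rw [← Finset.sum_filter]
  apply Finset.sum_bij (fun n _ => (n.val : ℤ) + 1)
  · intro n; simp
  · intro a _ b _ h; ext; omega
  · intro b hb
    simp only [Finset.mem_Ioc] at hb
    refine ⟨⟨(b - 1).toNat, by omega⟩, ?_, ?_⟩
    · simp; omega
    · simp only []; omega
  · intros; rfl

open scoped Classical in
lemma cmhz_aux (K : List (ℕ × ℂ × ℂ)) (m N : ℕ) :
    (∑ n : Fin K.length → Fin N, if StrictMono n ∧ ∀ j, m ≤ (n j).val then
      ∏ j : Fin K.length, tf (K.get j) (((n j).val : ℤ) + 1) else 0) = nestI (K.map tf) m N := by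
  induction K generalizing m with
  | nil =>
    have : ∀ n : Fin 0 → Fin N, StrictMono n := fun n i => i.elim0
    simp [this]
  | cons c K ih =>
    rw [List.map_cons, nestI_cons, ← sum_fin_Ioc]
    have e := Equiv.sum_comp (Fin.consEquiv (fun _ : Fin (K.length + 1) => Fin N))
      (fun n : Fin (K.length+1) → Fin N => if StrictMono n ∧ ∀ j, m ≤ (n j).val then
      ∏ j : Fin (K.length+1), tf ((c :: K).get j) (((n j).val : ℤ) + 1) else 0)
    refine e.symm.trans ?_
    rw [Fintype.sum_prod_type]
    refine Finset.sum_congr rfl fun a _ => ?_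
    have h2 := ih (a.val + 1)
    push_cast at h2
    rw [← h2]
    split_ifs with h
    · rw [Finset.mul_sum]
      refine Finset.sum_congr rfl fun f _ => ?_
      have : (StrictMono (Fin.cons a f : Fin (K.length+1) → Fin N) ∧ ∀ j, m ≤ ((Fin.cons a f : Fin (K.length+1) → Fin N) j).val) ↔ (StrictMono f ∧ ∀ j, a.val + 1 ≤ (f j).val) := by
        rw [strictMono_cons_iff, Fin.forall_fin_succ]
        simp only [Fin.cons_zero, Fin.cons_succ, Fin.lt_def]
        constructor
        · rintro ⟨⟨h1, h2⟩, h3, h4⟩; exact ⟨h2, fun j => h1 j⟩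
        · rintro ⟨h1, h2⟩; exact ⟨⟨fun j => h2 j, h1⟩, h, fun j => by have := h2 j; omega⟩
      refine (if_congr this rfl rfl).trans ?_
      split_ifs
      · rw [Fin.prod_univ_succ]; simp [Fin.consEquiv]
      · simp
    · apply Finset.sum_eq_zero
      intro f _
      rw [if_neg]
      rintro ⟨_, h3⟩
      have := h3 0
      simp at this; omega

lemma cmhzP_eq (K : List (ℕ × ℂ × ℂ)) (N : ℕ) : cmhzP K N = nestI (K.map tf) 0 N := by
  classical
  have h := cmhz_aux K 0 N
  simp only [Nat.zero_le, implies_true, and_true, Nat.cast_zero] at h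
  rw [← h, cmhzP, Finset.sum_filter]
  refine Finset.sum_congr (by congr) fun n _ => ?_
  refine if_congr Iff.rfl (Finset.prod_congr rfl fun j _ => ?_) rfl
  simp only [tf]
  push_cast
  congr 1

/-- good triples -/
def Good (c : ℕ × ℂ × ℂ) : Prop :=
  0 < c.1 ∧ ‖c.2.1‖ = 1 ∧ ∀ n : ℤ, 1 ≤ n → (n : ℂ) + c.2.2 - 1 ≠ 0

/-- admissible lists -/
def Adm (K : List (ℕ × ℂ × ℂ)) : Prop :=
  (∀ c ∈ K, Good c) ∧ ∀ c ∈ K.getLast?, ¬(c.1 = 1 ∧ c.2.1 = 1)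

lemma Adm.tail {c d} {K : List (ℕ × ℂ × ℂ)} (h : Adm (c :: d :: K)) : Adm (d :: K) := by
  refine ⟨fun e he => h.1 e (List.mem_cons_of_mem _ he), fun e he => h.2 e ?_⟩
  simpa using he

lemma tendsto_int_of_nat {u : ℤ → ℂ} {l : Filter ℂ} (h : Tendsto (fun N : ℕ => u N) atTop l) :
    Tendsto u atTop l := by
  have h1 : Tendsto Int.toNat atTop atTop :=
    tendsto_atTop.2 (fun b => eventually_atTop.2 ⟨b, by intros; omega⟩)
  exact (h.comp h1).congr' (eventually_atTop.2 ⟨0, fun n hn => by simp [hn]⟩)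

lemma inv_bound (b : ℂ) : ∃ C : ℝ, 0 ≤ C ∧ ∀ n : ℤ, 1 ≤ n → ‖((n : ℂ) + b - 1)⁻¹‖ ≤ C / n := by
  have h1 : Tendsto (fun n : ℕ => (n : ℂ) / ((n : ℂ) + (b - 1))) atTop (𝓝 1) :=
    tendsto_natCast_div_add_atTop (b - 1)
  obtain ⟨C, hC⟩ := (Metric.isBounded_range_of_tendsto _ h1).exists_norm_le
  refine ⟨C, (norm_nonneg _).trans (hC _ ⟨0, rfl⟩), fun n hn => ?_⟩
  have := hC _ ⟨n.toNat, rfl⟩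
  have e : ((n.toNat : ℕ) : ℂ) = (n : ℂ) := by
    have : ((n.toNat : ℕ) : ℤ) = n := by omega
    exact_mod_cast this
  have hn' : (0 : ℝ) < n := by exact_mod_cast hn
  simp only [e, norm_div, Complex.norm_intCast, abs_of_pos hn'] at this
  rw [le_div_iff₀ hn', norm_inv, add_sub_assoc]
  rw [mul_comm, ← div_eq_mul_inv]; exact this

lemma tf_bound (c : ℕ × ℂ × ℂ) (hx : ‖c.2.1‖ = 1) :
    ∃ C : ℝ, 0 ≤ C ∧ ∀ n : ℤ, 1 ≤ n → ‖tf c n‖ ≤ C / (n : ℝ) ^ c.1 := by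
  obtain ⟨C, hC, h⟩ := inv_bound c.2.2
  refine ⟨C ^ c.1, by positivity, fun n hn => ?_⟩
  rw [tf, norm_div, norm_zpow, hx, one_zpow, norm_pow, ← div_pow, one_div, ← inv_pow, ← norm_inv]
  exact pow_le_pow_left₀ (norm_nonneg _) (h n hn) _

lemma tf_bound1 (c : ℕ × ℂ × ℂ) (hc : Good c) :
    ∃ C : ℝ, 0 ≤ C ∧ ∀ n : ℤ, 1 ≤ n → ‖tf c n‖ ≤ C / (n : ℝ) := by
  obtain ⟨C, hC, h⟩ := tf_bound c hc.2.1
  refine ⟨C, hC, fun n hn => (h n hn).trans ?_⟩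
  have hn' : (1 : ℝ) ≤ n := by exact_mod_cast hn
  gcongr
  exact le_self_pow₀ hn' hc.1.ne'

lemma sum_Ioc_int_succ {E : Type*} [AddCommMonoid E] (g : ℤ → E) {m N : ℤ} (h : m ≤ N) :
    ∑ n ∈ Finset.Ioc m (N + 1), g n = ∑ n ∈ Finset.Ioc m N, g n + g (N + 1) := by
  have : Finset.Ioc m (N + 1) = insert (N + 1) (Finset.Ioc m N) := by ext n; simp; omega
  rw [this, Finset.sum_insert (by simp), add_comm]

lemma sum_inv_sq (m N : ℤ) (hm : 1 ≤ m) : ∑ n ∈ Finset.Ioc m N, 1 / (n : ℝ) ^ 2 ≤ 1 / (m : ℝ) := by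
  have hm' : (1 : ℝ) ≤ m := by exact_mod_cast hm
  rcases le_or_gt m N with h | h
  · have : ∑ n ∈ Finset.Ioc m N, 1 / (n : ℝ) ^ 2 ≤ 1 / (m : ℝ) - 1 / (N : ℝ) := by
      induction N, h using Int.leInduction with
      | base => simp
      | succ N hN ih =>
        rw [sum_Ioc_int_succ _ hN]
        have hN' : (1 : ℝ) ≤ N := by exact_mod_cast hm.trans hN
        have : 1 / ((N + 1 : ℤ) : ℝ) ^ 2 ≤ 1 / N - 1 / ((N + 1 : ℤ) : ℝ) := by
          push_cast
          rw [div_sub_div _ _ (by positivity) (by positivity), div_le_div_iff₀ (by positivity) (by positivity)]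
          nlinarith
        linarith
    have hN' : (0 : ℝ) ≤ N := by exact_mod_cast (by omega : (0 : ℤ) ≤ N)
    have : 0 ≤ 1 / (N : ℝ) := by positivity
    linarith
  · rw [Finset.Ioc_eq_empty (by omega)]; rw [Finset.sum_empty]; positivity

lemma sum_bound_sq (g : ℤ → ℂ) (C : ℝ) (hC : 0 ≤ C) (h : ∀ n : ℤ, 1 ≤ n → ‖g n‖ ≤ C / (n : ℝ) ^ 2)
    (m N : ℤ) (hm : 1 ≤ m) : ‖∑ n ∈ Finset.Ioc m N, g n‖ ≤ C / m := by
  calc ‖∑ n ∈ Finset.Ioc m N, g n‖ ≤ ∑ n ∈ Finset.Ioc m N, C * (1 / (n : ℝ) ^ 2) := by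
        refine norm_sum_le_of_le _ fun n hn => ?_
        rw [Finset.mem_Ioc] at hn
        rw [mul_one_div]; exact h n (by omega)
    _ ≤ C * (1 / m) := by
        rw [← Finset.mul_sum]; exact mul_le_mul_of_nonneg_left (sum_inv_sq m N hm) hC
    _ = C / m := by ring

lemma single_bound (c : ℕ × ℂ × ℂ) (hc : Good c) (h1 : ¬(c.1 = 1 ∧ c.2.1 = 1)) :
    ∃ C : ℝ, 0 ≤ C ∧ ∀ m N : ℤ, 1 ≤ m → ‖∑ n ∈ Finset.Ioc m N, tf c n‖ ≤ C / m := by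
  rcases Nat.lt_or_ge 1 c.1 with h2 | h2
  · obtain ⟨C, hC, h⟩ := tf_bound c hc.2.1
    refine ⟨C, hC, fun m N hm => sum_bound_sq _ C hC (fun n hn => (h n hn).trans ?_) m N hm⟩
    have hn' : (1 : ℝ) ≤ n := by exact_mod_cast hn
    gcongr
    exact h2
  · have hk : c.1 = 1 := by have := hc.1; omega
    have hx : c.2.1 ≠ 1 := fun h => h1 ⟨hk, h⟩
    have hx0 : c.2.1 ≠ 0 := by intro h; have := hc.2.1; rw [h] at this; simp at this
    obtain ⟨k, x, b⟩ := c
    simp only at hk hx hx0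
    subst hk
    have hxn : ‖x‖ = 1 := hc.2.1
    obtain ⟨C, hC, h⟩ := inv_bound b
    have hnz : ∀ n : ℤ, 1 ≤ n → (n : ℂ) + b - 1 ≠ 0 := hc.2.2
    set u : ℤ → ℂ := fun n => ((n : ℂ) + b - 1)⁻¹ with hu
    have hpos : 0 < ‖x - 1‖ := norm_pos_iff.2 (sub_ne_zero.2 hx)
    refine ⟨(C + C + C * C) / ‖x - 1‖, by positivity, fun m N hm => ?_⟩
    have hm' : (1 : ℝ) ≤ m := by exact_mod_cast hm
    rcases le_or_gt m N with hmN | hmN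
    swap
    · rw [Finset.Ioc_eq_empty (by omega)]; simp; positivity
    have key : (x - 1) * ∑ n ∈ Finset.Ioc m N, tf (1, x, b) n =
        x ^ (N + 1) * u N - x ^ (m + 1) * u m - ∑ n ∈ Finset.Ioc m N, x ^ n * (u n - u (n - 1)) := by
      induction N, hmN using Int.leInduction with
      | base => simp
      | succ N hN ih =>
        rw [sum_Ioc_int_succ _ hN, sum_Ioc_int_succ _ hN, mul_add, ih]
        have : tf (1, x, b) (N + 1) = x ^ (N + 1) * u (N + 1) := by
          simp [tf, hu, div_eq_mul_inv]
        rw [this, zpow_add_one₀ hx0 (N + 1)]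
        simp only [add_sub_cancel_right]
        ring
    have e3 : ‖∑ n ∈ Finset.Ioc m N, x ^ n * (u n - u (n - 1))‖ ≤ C * C / m := by
      have : ∑ n ∈ Finset.Ioc m N, x ^ n * (u n - u (n - 1)) =
          ∑ n ∈ Finset.Ioc (m - 1) (N - 1), x ^ (n + 1) * (u (n + 1) - u n) := by
        rw [sum_Ioc_shift _ m N (-1)]
        simp [sub_eq_add_neg]
      have hb : ∀ n ∈ Finset.Ioc m N, ‖x ^ n * (u n - u (n - 1))‖ ≤ C * C * (1 / ((n - 1 : ℤ) : ℝ) - 1 / (n : ℝ)) := by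
        intro n hn
        rw [Finset.mem_Ioc] at hn
        have h1 := hnz n (by omega)
        have h2 := hnz (n - 1) (by omega)
        have e : u n - u (n - 1) = - (u n * u (n - 1)) := by
          simp only [hu]
          rw [inv_sub_inv h1 h2, ← mul_inv, div_eq_mul_inv]
          push_cast; ring
        rw [e, norm_mul, norm_zpow, hxn, one_zpow, one_mul, norm_neg, norm_mul]
        refine (mul_le_mul (h n (by omega)) (h (n - 1) (by omega)) (norm_nonneg _) ?_).trans ?_
        · have : (0 : ℝ) ≤ n := by exact_mod_cast (by omega : (0 : ℤ) ≤ n)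
          positivity
        · have h1 : (0 : ℝ) < n := by exact_mod_cast (by omega : (0 : ℤ) < n)
          have h2 : (0 : ℝ) < ((n - 1 : ℤ) : ℝ) := by exact_mod_cast (by omega : (0 : ℤ) < n - 1)
          apply le_of_eq
          rw [div_sub_div _ _ h2.ne' h1.ne', div_mul_div_comm]
          push_cast
          field_simp
          ring
      refine (norm_sum_le_of_le _ hb).trans ?_
      rw [← Finset.mul_sum, div_eq_mul_one_div (C * C)]
      refine mul_le_mul_of_nonneg_left ?_ (mul_nonneg hC hC)
      have : ∑ n ∈ Finset.Ioc m N, (1 / ((n - 1 : ℤ) : ℝ) - 1 / (n : ℝ)) = 1 / (m : ℝ) - 1 / (N : ℝ) := by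
        clear key this hb
        induction N, hmN using Int.leInduction with
        | base => simp
        | succ N hN ih =>
          rw [sum_Ioc_int_succ _ hN, ih]
          simp
      rw [this]
      have hN' : (0 : ℝ) ≤ N := by exact_mod_cast (by omega : (0 : ℤ) ≤ N)
      have : 0 ≤ 1 / (N : ℝ) := by positivity
      linarith
    have hN1 : ‖x ^ (N + 1) * u N‖ ≤ C / m := by
      rw [norm_mul, norm_zpow, hxn, one_zpow, one_mul]
      refine (h N (by omega)).trans ?_
      have : (m : ℝ) ≤ N := by exact_mod_cast hmN
      gcongr
    have hm1 : ‖x ^ (m + 1) * u m‖ ≤ C / m := by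
      rw [norm_mul, norm_zpow, hxn, one_zpow, one_mul]
      exact h m hm
    have : ‖x - 1‖ * ‖∑ n ∈ Finset.Ioc m N, tf (1, x, b) n‖ ≤ (C + C + C * C) / m := by
      rw [← norm_mul, key, add_div, add_div]
      refine (norm_sub_le _ _).trans (add_le_add ((norm_sub_le _ _).trans (add_le_add hN1 hm1)) e3)
    rw [div_right_comm, le_div_iff₀ hpos, mul_comm]
    exact this

lemma tail_bound (K : List (ℕ × ℂ × ℂ)) (hK : Adm K) (hne : K ≠ []) :
    ∃ C : ℝ, 0 ≤ C ∧ ∀ m N : ℤ, 1 ≤ m → ‖nestI (K.map tf) m N‖ ≤ C / m := by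
  induction K with
  | nil => exact absurd rfl hne
  | cons c K ih =>
    cases K with
    | nil =>
      obtain ⟨C, hC, h⟩ := single_bound c (hK.1 c (by simp)) (hK.2 c (by simp))
      refine ⟨C, hC, fun m N hm => ?_⟩
      simpa [nestI_cons] using h m N hm
    | cons d K =>
      obtain ⟨C, hC, h⟩ := ih hK.tail (by simp)
      obtain ⟨C', hC', h'⟩ := tf_bound1 c (hK.1 c (by simp))
      refine ⟨C' * C, by positivity, fun m N hm => ?_⟩
      rw [List.map_cons, nestI_cons]
      have hm' : (1 : ℝ) ≤ m := by exact_mod_cast hm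
      calc _ ≤ ∑ n ∈ Finset.Ioc m N, (C' * C) * (1 / (n : ℝ) ^ 2) := by
            refine norm_sum_le_of_le _ fun n hn => ?_
            rw [Finset.mem_Ioc] at hn
            have hn0 : (0 : ℝ) ≤ n := by exact_mod_cast (by omega : (0 : ℤ) ≤ n)
            rw [norm_mul]
            refine (mul_le_mul (h' n (by omega)) (h n N (by omega)) (norm_nonneg _) (by positivity)).trans ?_
            apply le_of_eq; rw [div_mul_div_comm]; ring
        _ ≤ (C' * C) * (1 / m) := by
            rw [← Finset.mul_sum]; exact mul_le_mul_of_nonneg_left (sum_inv_sq m N hm) (by positivity)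
        _ = _ := by ring

lemma tannery {ι : Type*} {F : Filter ι} (c : ℕ × ℂ × ℂ) (hc : Good c) (K : List (ℕ × ℂ × ℂ))
    (hK : Adm K) (hne : K ≠ []) (m : ℤ) (hm : 0 ≤ m) (b : ι → ℤ → ℤ) (J : ℤ → ℂ)
    (h : ∀ n, m < n → Tendsto (fun i => nestI (K.map tf) n (b i n)) F (𝓝 (J n))) :
    Tendsto (fun i => ∑' s : ℕ, tf c (m + 1 + s) * nestI (K.map tf) (m + 1 + s) (b i (m + 1 + s))) F
      (𝓝 (∑' s : ℕ, tf c (m + 1 + s) * J (m + 1 + s))) := by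
  obtain ⟨C, hC, hb⟩ := tail_bound K hK hne
  obtain ⟨C', hC', hb'⟩ := tf_bound1 c hc
  apply tendsto_tsum_of_dominated_convergence (bound := fun s : ℕ => (C' * C) * (1 / ((s + 1 : ℕ) : ℝ) ^ 2))
  · apply Summable.mul_left
    exact (summable_nat_add_iff 1).2 (Real.summable_one_div_nat_pow.2 (by norm_num : 1 < 2))
  · intro s
    exact (h _ (by omega)).const_mul _
  · refine Eventually.of_forall fun i s => ?_
    have h1 : (1 : ℤ) ≤ m + 1 + s := by omega
    have h2 : ((s + 1 : ℕ) : ℝ) ≤ ((m + 1 + s : ℤ) : ℝ) := by exact_mod_cast (by push_cast; omega : ((s + 1 : ℕ) : ℤ) ≤ m + 1 + s)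
    have h3 : (0 : ℝ) < ((s + 1 : ℕ) : ℝ) := by positivity
    have h4 : (0 : ℝ) < ((m + 1 + s : ℤ) : ℝ) := h3.trans_le h2
    rw [norm_mul]
    refine (mul_le_mul (hb' _ h1) (hb _ _ h1) (norm_nonneg _) (by positivity)).trans ?_
    rw [div_mul_div_comm, ← pow_two, mul_one_div]
    gcongr

lemma sum_Ioc_tsum (g : ℤ → ℂ) (m N : ℤ) (g' : ℤ → ℂ) (h1 : ∀ n, m < n → n ≤ N → g' n = g n)
    (h2 : ∀ n, m < n → N < n → g' n = 0) :
    ∑ n ∈ Finset.Ioc m N, g n = ∑' s : ℕ, g' (m + 1 + s) := by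
  rw [tsum_eq_sum (s := Finset.range (N - m).toNat)]
  · apply Finset.sum_bij' (fun n _ => (n - m - 1).toNat) (fun s _ => m + 1 + s)
    · intro n; simp; omega
    · intro n; simp; omega
    · intro n; simp; omega
    · intro n; simp; omega
    · intro n hn
      rw [Finset.mem_Ioc] at hn
      rw [show m + 1 + ((n - m - 1).toNat : ℤ) = n by omega]
      exact (h1 n hn.1 hn.2).symm
  · intro s hs
    simp at hs
    exact h2 _ (by omega) (by omega)

lemma nestI_tendsto (K : List (ℕ × ℂ × ℂ)) (hK : Adm K) (m : ℤ) (hm : 0 ≤ m) :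
    ∃ J, Tendsto (fun N : ℤ => nestI (K.map tf) m N) atTop (𝓝 J) := by
  induction K generalizing m with
  | nil => exact ⟨1, by simp⟩
  | cons c K ih =>
    cases K with
    | nil =>
      obtain ⟨C, hC, h⟩ := single_bound c (hK.1 c (by simp)) (hK.2 c (by simp))
      have : CauchySeq (fun N : ℕ => nestI ([c].map tf) m (m + 1 + N)) := by
        apply cauchySeq_of_le_tendsto_0' (fun N : ℕ => C / ((N + 1 : ℕ) : ℝ))
        · intro n n' hn
          rw [dist_comm, dist_eq_norm]
          have e : nestI ([c].map tf) m (m + 1 + n') - nestI ([c].map tf) m (m + 1 + n) =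
              ∑ p ∈ Finset.Ioc (m + 1 + n) (m + 1 + n' : ℤ), tf c p := by
            simp only [List.map_cons, List.map_nil, nestI_cons, nestI_nil, mul_one]
            rw [sub_eq_iff_eq_add, add_comm, ← Finset.sum_union]
            · congr 1; ext p; simp; omega
            · rw [Finset.disjoint_left]; intro p; simp; omega
          rw [e]
          refine (h _ _ (by omega)).trans ?_
          have h2 : ((n + 1 : ℕ) : ℝ) ≤ ((m + 1 + n : ℤ) : ℝ) := by exact_mod_cast (by push_cast; omega : ((n + 1 : ℕ) : ℤ) ≤ m + 1 + n)
          gcongr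
        · exact ((tendsto_const_div_atTop_nhds_zero_nat C).comp (tendsto_add_atTop_nat 1))
      obtain ⟨J, hJ⟩ := cauchySeq_tendsto_of_complete this
      refine ⟨J, ?_⟩
      have h2 := tendsto_int_of_nat (u := fun N => nestI ([c].map tf) m (m + 1 + N)) hJ
      have h3 := h2.comp (tendsto_atTop_add_const_right atTop (-(m + 1)) tendsto_id)
      refine h3.congr fun N => ?_
      simp only [Function.comp, id]
      congr 1; ring
    | cons d K =>
      have ih' := fun n hn => ih hK.tail n hn
      choose! J hJ using ih'
      refine ⟨_, (tannery c (hK.1 c (by simp)) (d :: K) hK.tail (by simp) m hm (fun N _ => N) J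
        (fun n hn => hJ n (by omega))).congr fun N => ?_⟩
      rw [List.map_cons (a := c), nestI_cons]
      rw [sum_Ioc_tsum (fun n => tf c n * nestI (List.map tf (d :: K)) n N) m N (fun n => tf c n * nestI (List.map tf (d :: K)) n N) (fun _ _ _ => rfl)]
      intro n _ hn
      rw [nestI_eq_zero (by simp) hn.le, mul_zero]

lemma cmhz_tendsto (K : List (ℕ × ℂ × ℂ)) (hK : Adm K) :
    Tendsto (fun N : ℤ => nestI (K.map tf) 0 N) atTop (𝓝 (cmhz K)) := by
  obtain ⟨J, hJ⟩ := nestI_tendsto K hK 0 le_rfl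
  have h1 : Tendsto (cmhzP K) atTop (𝓝 J) := by
    refine (hJ.comp tendsto_natCast_atTop_atTop).congr fun N => ?_
    rw [cmhzP_eq]; rfl
  rw [cmhz, h1.limUnder_eq]; exact hJ

lemma cmhz_cons_tendsto (c : ℕ × ℂ × ℂ) (K : List (ℕ × ℂ × ℂ)) (hK : Adm (c :: K)) (hne : K ≠ []) :
    Tendsto (fun N : ℕ => ∑' s : ℕ, tf c (0 + 1 + s) * nestI (K.map tf) (0 + 1 + s) (0 + 1 + s + N)) atTop
      (𝓝 (cmhz (c :: K))) := by
  cases K with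
  | nil => exact absurd rfl hne
  | cons d K =>
    have hc := hK.1 c (by simp)
    have ih' := fun n hn => nestI_tendsto (d :: K) hK.tail n hn
    choose! J hJ using ih'
    have h1 := tannery c hc (d :: K) hK.tail (by simp) 0 le_rfl (fun (N : ℤ) _ => N) J
        (fun n hn => hJ n (by omega))
    have h2 := tannery c hc (d :: K) hK.tail (by simp) 0 le_rfl (fun (N : ℕ) n => n + N) J
        (fun n hn => by
          have := hJ n (by omega)
          exact this.comp (tendsto_atTop_add_const_left _ _ tendsto_natCast_atTop_atTop))
    have h3 := cmhz_tendsto _ hK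
    have h4 : Tendsto (fun N : ℤ => nestI ((c :: d :: K).map tf) 0 N) atTop
        (𝓝 (∑' (s : ℕ), tf c (0 + 1 + s) * J (0 + 1 + s))) := by
      refine h1.congr fun N => ?_
      rw [List.map_cons (a := c), nestI_cons]
      rw [sum_Ioc_tsum (fun n => tf c n * nestI (List.map tf (d :: K)) n N) 0 N (fun n => tf c n * nestI (List.map tf (d :: K)) n N) (fun _ _ _ => rfl)]
      intro n _ hn
      rw [nestI_eq_zero (by simp) hn.le, mul_zero]
    rw [tendsto_nhds_unique h3 h4]
    exact h2

/-- Cesàro convergence -/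
def CesL (u : ℕ → ℂ) (l : ℂ) : Prop :=
  Tendsto (fun N : ℕ => (N : ℝ)⁻¹ • ∑ n ∈ Finset.range N, u n) atTop (𝓝 l)

lemma CesL.of_tendsto {u : ℕ → ℂ} {l : ℂ} (h : Tendsto u atTop (𝓝 l)) : CesL u l := h.cesaro_smul

lemma CesL.add {u v : ℕ → ℂ} {l l' : ℂ} (h : CesL u l) (h' : CesL v l') :
    CesL (fun n => u n + v n) (l + l') := by
  refine (Tendsto.add h h').congr fun N => ?_
  rw [Finset.sum_add_distrib, smul_add]

lemma CesL.const_mul {u : ℕ → ℂ} {l : ℂ} (h : CesL u l) (c : ℂ) :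
    CesL (fun n => c * u n) (c * l) := by
  refine (Tendsto.const_mul c h).congr fun N => ?_
  rw [← Finset.mul_sum, mul_smul_comm]

lemma CesL.sum {ι : Type*} (s : Finset ι) {u : ι → ℕ → ℂ} {l : ι → ℂ} (h : ∀ i ∈ s, CesL (u i) (l i)) :
    CesL (fun n => ∑ i ∈ s, u i n) (∑ i ∈ s, l i) := by
  refine (tendsto_finsetSum s h).congr fun N => ?_
  rw [Finset.sum_comm, Finset.smul_sum]

lemma CesL.unique {u : ℕ → ℂ} {l l' : ℂ} (h : CesL u l) (h' : CesL u l') : l = l' :=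
  tendsto_nhds_unique h h'

lemma cesL_conv (A β : ℕ → ℂ) (a b : ℂ) (hA0 : A 0 = 0) (hA : Tendsto A atTop (𝓝 a))
    (hβ : Tendsto β atTop (𝓝 b)) :
    CesL (fun N => ∑ p ∈ Finset.range N, (A (p + 1) - A p) * β (N - 1 - p)) (a * b) := by
  have key : ∀ N : ℕ, ∑ n ∈ Finset.range N, ∑ p ∈ Finset.range n, (A (p + 1) - A p) * β (n - 1 - p) =
      ∑ s ∈ Finset.range N, β s * A (N - 1 - s) := by
    intro N
    induction N with
    | zero => simp
    | succ N ih =>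
      rw [Finset.sum_range_succ, ih, Finset.sum_range_succ]
      simp only [add_tsub_cancel_right, tsub_self, hA0, mul_zero, add_zero]
      rw [← Finset.sum_range_reflect (fun p => (A (p + 1) - A p) * β (N - 1 - p)), ← Finset.sum_add_distrib]
      refine Finset.sum_congr rfl fun s hs => ?_
      rw [Finset.mem_range] at hs
      rw [show N - 1 - (N - 1 - s) = s by omega, show N - 1 - s + 1 = N - s by omega]
      ring
  unfold CesL
  simp only [key]
  obtain ⟨C, hC⟩ := (Metric.isBounded_range_of_tendsto _ hA).exists_norm_le
  have h1 : Tendsto (fun N : ℕ => (N : ℝ)⁻¹ • ∑ s ∈ Finset.range N, (β s - b) * A (N - 1 - s)) atTop (𝓝 0) := by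
    have h2 : Tendsto (fun s => ‖β s - b‖) atTop (𝓝 0) := by
      rw [← tendsto_iff_norm_sub_tendsto_zero]; exact hβ
    have h3 := (h2.cesaro).mul_const C
    rw [zero_mul] at h3
    refine squeeze_zero_norm (fun N => ?_) h3
    rw [norm_smul, norm_inv, Real.norm_natCast, mul_assoc, Finset.sum_mul]
    gcongr
    refine norm_sum_le_of_le _ fun s _ => ?_
    rw [norm_mul]
    gcongr
    exact hC _ ⟨_, rfl⟩
  have h4 : Tendsto (fun N : ℕ => (N : ℝ)⁻¹ • ∑ s ∈ Finset.range N, b * A (N - 1 - s)) atTop (𝓝 (a * b)) := by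
    have := (CesL.of_tendsto hA).const_mul b
    rw [mul_comm] at this
    refine Tendsto.congr (fun N => ?_) this
    rw [Finset.sum_range_reflect (fun n => b * A n)]
  have := h1.add h4
  rw [zero_add] at this
  refine this.congr fun N => ?_
  rw [← smul_add, ← Finset.sum_add_distrib]
  congr 1
  refine Finset.sum_congr rfl fun s _ => by ring

/-- the expansion of `(d+X)^{-k}` -/
noncomputable def GS (d : ℂ) (k : ℕ) : PowerSeries ℂ :=
  PowerSeries.mk fun m => (-1) ^ m * (Nat.choose (m + k - 1) (k - 1) : ℂ) * (d ^ (k + m))⁻¹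

lemma GS_mul (d : ℂ) (hd : d ≠ 0) (k : ℕ) (hk : 0 < k) :
    GS d k * (PowerSeries.C d + PowerSeries.X) ^ k = 1 := by
  obtain ⟨e, rfl⟩ : ∃ e, k = e + 1 := ⟨k - 1, by omega⟩
  have h1 : GS d (e + 1) = (PowerSeries.C d⁻¹ * PowerSeries.rescale (-d⁻¹) (PowerSeries.mk 1)) ^ (e + 1) := by
    rw [mul_pow, ← map_pow (PowerSeries.rescale (-d⁻¹)), PowerSeries.mk_one_pow_eq_mk_choose_add, ← map_pow]
    ext n
    rw [PowerSeries.coeff_C_mul, PowerSeries.coeff_rescale, PowerSeries.coeff_mk, GS, PowerSeries.coeff_mk]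
    rw [show n + (e + 1) - 1 = e + n by omega, show e + 1 - 1 = e by omega, neg_pow d⁻¹, pow_add, mul_inv, inv_pow, inv_pow]
    ring
  have h2 : PowerSeries.rescale (-d⁻¹) (PowerSeries.mk 1) * (1 + PowerSeries.C d⁻¹ * PowerSeries.X) = 1 := by
    have := congrArg (PowerSeries.rescale (-d⁻¹)) (PowerSeries.mk_one_mul_one_sub_eq_one ℂ)
    rw [map_mul, map_sub, map_one, PowerSeries.rescale_X] at this
    rwa [map_neg, neg_mul, sub_neg_eq_add] at this
  rw [h1, ← mul_pow]
  have h3 : (PowerSeries.C d⁻¹ * PowerSeries.rescale (-d⁻¹) (PowerSeries.mk 1)) * (PowerSeries.C d + PowerSeries.X) = 1 := by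
    calc _ = PowerSeries.rescale (-d⁻¹) (PowerSeries.mk 1) * (PowerSeries.C d⁻¹ * PowerSeries.C d + PowerSeries.C d⁻¹ * PowerSeries.X) := by ring
      _ = _ := by rw [← map_mul, inv_mul_cancel₀ hd, map_one, h2]
  rw [h3, one_pow]

open Polynomial in
lemma pf_local (Q : ℂ[X]) (G : PowerSeries ℂ) (k : ℕ) (h : G * (Q : PowerSeries ℂ) = 1) :
    (X : ℂ[X]) ^ k ∣ Q * (∑ i ∈ Finset.range k, C (PowerSeries.coeff (k - 1 - i) G) * X ^ (k - 1 - i)) - 1 := by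
  rw [Finset.sum_range_reflect (fun i => C (PowerSeries.coeff i G) * X ^ i)]
  rw [Polynomial.X_pow_dvd_iff]
  intro n hn
  have h1 : PowerSeries.coeff n (G * (Q : PowerSeries ℂ)) = PowerSeries.coeff n (1 : PowerSeries ℂ) := by rw [h]
  rw [PowerSeries.coeff_mul] at h1
  rw [coeff_sub, mul_comm, coeff_mul, sub_eq_zero]
  have h2 : (1 : ℂ[X]).coeff n = PowerSeries.coeff n (1 : PowerSeries ℂ) := by
    rw [← Polynomial.coe_one, Polynomial.coeff_coe]
  rw [h2, ← h1]
  refine Finset.sum_congr rfl fun p hp => ?_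
  rw [Polynomial.coeff_coe]
  congr 1
  have : p.1 < k := by have := Finset.HasAntidiagonal.mem_antidiagonal.1 hp; omega
  simp [Polynomial.coeff_X_pow, this]

open Polynomial in
lemma pf_poly {ι : Type*} [DecidableEq ι] (s : Finset ι) (hs : s.Nonempty) (k : ι → ℕ) (hk : ∀ i ∈ s, 0 < k i)
    (c : ι → ℂ) (hc : ∀ i ∈ s, ∀ j ∈ s, i ≠ j → c i ≠ c j) :
    ∑ j ∈ s, (∏ l ∈ s.erase j, (X + C (c l)) ^ k l) * ∑ i ∈ Finset.range (k j),
      C (PowerSeries.coeff (k j - 1 - i) (∏ l ∈ s.erase j, GS (c l - c j) (k l))) *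
        (X + C (c j)) ^ (k j - 1 - i) = (1 : ℂ[X]) := by
  rw [← sub_eq_zero]
  have hmon : (∏ l ∈ s, (X + C (c l)) ^ k l).Monic :=
    monic_prod_of_monic _ _ fun l _ => (monic_X_add_C _).pow _
  have hdeg : (∏ l ∈ s, (X + C (c l)) ^ k l).natDegree = ∑ l ∈ s, k l := by
    rw [natDegree_prod_of_monic _ _ fun l _ => (monic_X_add_C _).pow _]
    simp [natDegree_pow]
  obtain ⟨j0, hj0⟩ := hs
  have hpos : 0 < ∑ l ∈ s, k l := Finset.sum_pos hk ⟨j0, hj0⟩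
  by_contra hne
  refine hmon.not_dvd_of_natDegree_lt hne ?_ ?_
  swap
  · apply Finset.prod_dvd_of_coprime
    · intro i hi j hj hij
      apply IsCoprime.pow
      have := Polynomial.isCoprime_X_sub_C_of_isUnit_sub (R := ℂ) (a := - c i) (b := - c j)
        (by rw [isUnit_iff_ne_zero]; intro h; exact hc i hi j hj hij (by linear_combination -h))
      simpa using this
    · intro j hj
      rw [← Finset.add_sum_erase _ _ hj, add_sub_right_comm]
      apply dvd_add
      · set G := ∏ l ∈ s.erase j, GS (c l - c j) (k l)
        have h := pf_local (∏ l ∈ s.erase j, (C (c l - c j) + X) ^ k l) G (k j) (by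
          rw [← Polynomial.coeToPowerSeries.ringHom_apply, map_prod, ← Finset.prod_mul_distrib]
          refine Finset.prod_eq_one fun l hl => ?_
          rw [map_pow, map_add]
          simp only [Polynomial.coeToPowerSeries.ringHom_apply, Polynomial.coe_X, Polynomial.coe_C]
          rw [Finset.mem_erase] at hl
          exact GS_mul _ (sub_ne_zero.2 (hc l hl.2 j hj hl.1)) _ (hk l hl.2))
        have h2 := map_dvd (Polynomial.compRingHom (X + C (c j))) h
        simp only [map_pow, map_sub, map_mul, map_one, map_prod, map_sum, map_add, Polynomial.coe_compRingHom_apply, X_comp, C_comp] at h2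
        convert h2 using 5
        ring
      · apply Finset.dvd_sum
        intro j' hj'
        rw [Finset.mem_erase] at hj'
        apply Dvd.dvd.mul_right
        exact Finset.dvd_prod_of_mem (fun l => (X + C (c l)) ^ k l) (Finset.mem_erase.2 ⟨hj'.1.symm, hj⟩)
  · rw [hdeg]
    have hlt : ∑ l ∈ s, k l - 1 < ∑ l ∈ s, k l := by omega
    refine lt_of_le_of_lt (natDegree_sub_le_of_le (n := ∑ l ∈ s, k l - 1) ?_ (by simp)) ((max_self _).trans_lt hlt)
    refine natDegree_sum_le_of_forall_le _ _ fun j hj => ?_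
    rw [Finset.mul_sum]
    refine natDegree_sum_le_of_forall_le _ _ fun i hi => ?_
    refine natDegree_mul_le.trans ?_
    have e1 : (∏ l ∈ s.erase j, (X + C (c l)) ^ k l).natDegree = ∑ l ∈ s.erase j, k l := by
      rw [natDegree_prod_of_monic _ _ fun l _ => (monic_X_add_C _).pow _]
      simp [natDegree_pow]
    have e2 : (C (PowerSeries.coeff (k j - 1 - i) (∏ l ∈ s.erase j, GS (c l - c j) (k l))) *
        (X + C (c j)) ^ (k j - 1 - i)).natDegree ≤ k j - 1 - i := by
      refine natDegree_C_mul_le _ _ |>.trans ?_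
      simp [natDegree_pow]
    rw [e1]
    have := Finset.add_sum_erase s k hj
    have := hk j hj
    omega

lemma partial_fractions {ι : Type*} [DecidableEq ι] (s : Finset ι) (hs : s.Nonempty) (k : ι → ℕ) (hk : ∀ i ∈ s, 0 < k i)
    (c : ι → ℂ) (hc : ∀ i ∈ s, ∀ j ∈ s, i ≠ j → c i ≠ c j) (y : ℂ) (hy : ∀ i ∈ s, y + c i ≠ 0) :
    ∏ l ∈ s, ((y + c l) ^ k l)⁻¹ = ∑ j ∈ s, ∑ i ∈ Finset.range (k j),
      ((y + c j) ^ (i + 1))⁻¹ * ∑ m ∈ Finset.finsuppAntidiag (s.erase j) (k j - 1 - i),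
        ∏ l ∈ s.erase j, ((-1) ^ m l * (Nat.choose (m l + k l - 1) (k l - 1) : ℂ) *
          ((c l - c j) ^ (k l + m l))⁻¹) := by
  have h := congrArg (Polynomial.eval y) (pf_poly s hs k hk c hc)
  simp only [Polynomial.eval_finsetSum, Polynomial.eval_mul, Polynomial.eval_prod, Polynomial.eval_pow, Polynomial.eval_add,
    Polynomial.eval_X, Polynomial.eval_C, Polynomial.eval_one, PowerSeries.coeff_prod] at h
  have h' := congrArg (fun z => (∏ l ∈ s, ((y + c l) ^ k l)⁻¹) * z) h
  simp only [mul_one] at h'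
  rw [← h', Finset.mul_sum]
  refine Finset.sum_congr rfl fun j hj => ?_
  rw [← Finset.mul_prod_erase _ _ hj, mul_assoc, ← mul_assoc (∏ l ∈ s.erase j, ((y + c l) ^ k l)⁻¹), ← Finset.prod_mul_distrib]
  rw [Finset.prod_eq_one (s := s.erase j), one_mul, Finset.mul_sum]
  · refine Finset.sum_congr rfl fun i hi => ?_
    rw [Finset.mem_range] at hi
    have e : (y + c j) ^ k j = (y + c j) ^ (i + 1) * (y + c j) ^ (k j - 1 - i) := by
      rw [← pow_add]; congr 1; omega
    have h0 := hy j hj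
    rw [e]
    simp only [GS, PowerSeries.coeff_mk]
    field_simp
  · intro l hl
    have h0 := hy l (Finset.mem_of_mem_erase hl)
    field_simp

/-- sum over chains `d s < d (s+1) < ⋯ < d (s+r) ≤ N`, the values `d 0, …, d s` being given. -/
noncomputable def chainS : ℕ → ℕ → ℤ → ((ℕ → ℤ) → ℂ) → (ℕ → ℤ) → ℂ
  | 0, _, _, F, d => F d
  | r + 1, s, N, F, d => ∑ n ∈ Finset.Ioc (d s) N, chainS r (s + 1) N F (Function.update d (s + 1) n)

/-- chain predicate -/
def IsChn (r s : ℕ) (d d' : ℕ → ℤ) : Prop :=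
  (∀ l, l ≤ s → d' l = d l) ∧ ∀ l, s ≤ l → l < s + r → d' l < d' (l + 1)

lemma IsChn.step {r s : ℕ} {d d' : ℕ → ℤ} {n : ℤ} (hn : d s < n)
    (h : IsChn r (s + 1) (Function.update d (s + 1) n) d') : IsChn (r + 1) s d d' := by
  refine ⟨fun l hl => ?_, fun l hl hl' => ?_⟩
  · rw [h.1 l (by omega), Function.update_of_ne (by omega)]
  · rcases Nat.eq_or_lt_of_le hl with e | e
    · subst e
      rw [h.1 s (by omega), h.1 (s + 1) (by omega), Function.update_self, Function.update_of_ne (by omega)]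
      exact hn
    · exact h.2 l (by omega) (by omega)

lemma chainS_tendsto {ι : Type*} {f : Filter ι} (r s : ℕ) (N : ℤ) (F : ι → (ℕ → ℤ) → ℂ)
    (G : (ℕ → ℤ) → ℂ) (d : ℕ → ℤ)
    (h : ∀ d', IsChn r s d d' → Tendsto (fun i => F i d') f (𝓝 (G d'))) :
    Tendsto (fun i => chainS r s N (F i) d) f (𝓝 (chainS r s N G d)) := by
  induction r generalizing s d with
  | zero => exact h d ⟨fun _ _ => rfl, fun l h1 h2 => by omega⟩
  | succ r ih =>
    simp only [chainS]
    refine tendsto_finsetSum _ fun n hn => ?_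
    rw [Finset.mem_Ioc] at hn
    exact ih _ _ fun d' hd' => h d' (hd'.step hn.1)

lemma chainS_congr (r s : ℕ) (N : ℤ) (F G : (ℕ → ℤ) → ℂ) (d : ℕ → ℤ)
    (h : ∀ d', IsChn r s d d' → F d' = G d') : chainS r s N F d = chainS r s N G d := by
  have := chainS_tendsto (f := (atTop : Filter ℕ)) r s N (fun _ => F) G d (fun d' hd' => by
    rw [h d' hd']; exact tendsto_const_nhds)
  exact tendsto_nhds_unique tendsto_const_nhds this

lemma chainS_sum {ι : Type*} (S : Finset ι) (r s : ℕ) (N : ℤ) (F : ι → (ℕ → ℤ) → ℂ) (d : ℕ → ℤ) :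
    chainS r s N (fun d => ∑ i ∈ S, F i d) d = ∑ i ∈ S, chainS r s N (F i) d := by
  induction r generalizing s d with
  | zero => rfl
  | succ r ih =>
    simp only [chainS, ih]
    rw [Finset.sum_comm]

lemma chainS_mul (r s : ℕ) (N : ℤ) (u : ℂ) (F : (ℕ → ℤ) → ℂ) (d : ℕ → ℤ) :
    chainS r s N (fun d => u * F d) d = u * chainS r s N F d := by
  induction r generalizing s d with
  | zero => rfl
  | succ r ih => simp only [chainS, ih, Finset.mul_sum]

lemma chainS_append (j r s : ℕ) (N : ℤ) (F : (ℕ → ℤ) → ℂ) (d : ℕ → ℤ) :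
    chainS (j + r) s N F d = chainS j s N (fun d' => chainS r (s + j) N F d') d := by
  induction j generalizing s d with
  | zero => simp [chainS]
  | succ j ih =>
    rw [show j + 1 + r = (j + r) + 1 by omega]
    simp only [chainS, ih]
    rw [show s + 1 + j = s + (j + 1) by omega]

lemma chainS_prod (r s : ℕ) (N : ℤ) (g : ℕ → ℤ → ℂ) (d : ℕ → ℤ) :
    chainS r s N (fun d => ∏ l ∈ Finset.range r, g l (d (s + 1 + l))) d =
      nestI (List.ofFn fun t : Fin r => g t.val) (d s) N := by
  induction r generalizing s d g with
  | zero => simp [chainS]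
  | succ r ih =>
    rw [chainS, List.ofFn_succ, nestI_cons]
    refine Finset.sum_congr rfl fun n _ => ?_
    have := ih (s + 1) (fun l => g (l + 1)) (Function.update d (s + 1) n)
    rw [Function.update_self] at this
    simp only [Fin.val_zero, Fin.val_succ]
    rw [← this, ← chainS_mul]
    apply chainS_congr
    intro d' hd'
    rw [Finset.prod_range_succ', mul_comm, add_zero, hd'.1 _ le_rfl, Function.update_self]
    congr 1
    refine Finset.prod_congr rfl fun l _ => ?_
    rw [show s + 1 + (l + 1) = s + 1 + 1 + l by omega]

lemma chainS_snoc (j s : ℕ) (N : ℤ) (F : (ℕ → ℤ) → ℂ) (d : ℕ → ℤ) :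
    chainS (j + 1) s N F d =
      ∑ D ∈ Finset.Ioc (d s) N, chainS j s (D - 1) (fun d' => F (Function.update d' (s + j + 1) D)) d := by
  induction j generalizing s d with
  | zero => simp [chainS]
  | succ j ih =>
    rw [chainS]
    simp only [ih, Function.update_self]
    rw [sum_Ioc_triangle]
    refine Finset.sum_congr rfl fun p _ => ?_
    rw [chainS]
    rw [show s + 1 + j + 1 = s + (j + 1) + 1 by omega]

lemma Q_zero (r : ℕ) (N : ℤ) (h : ℕ → ℤ → ℂ) :
    chainS r 0 N (fun d => ∏ l ∈ (Finset.range (r + 1)).erase 0, h l (d l - d 0)) 0 =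
      nestI (List.ofFn fun t : Fin r => h (t.val + 1)) 0 N := by
  rw [show (0 : ℤ) = (0 : ℕ → ℤ) 0 from rfl, ← chainS_prod r 0 N (fun t => h (t + 1)) 0]
  apply chainS_congr
  intro d hd
  have h0 : d 0 = 0 := hd.1 0 le_rfl
  have e3 : (Finset.range (r + 1)).erase 0 = (Finset.range r).map (addLeftEmbedding 1) := by
    ext l
    simp only [Finset.mem_erase, Finset.mem_range, Finset.mem_map, addLeftEmbedding_apply]
    constructor
    · intro hl
      exact ⟨l - 1, by omega, by omega⟩
    · rintro ⟨a, ha, rfl⟩; omega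
  rw [e3, Finset.prod_map]
  refine Finset.prod_congr rfl fun l _ => ?_
  rw [addLeftEmbedding_apply, h0, sub_zero, zero_add, add_comm 1 l]

lemma Q_succ (j r2 : ℕ) (N : ℤ) (h : ℕ → ℤ → ℂ) :
    chainS (j + 1 + r2) 0 N (fun d => ∏ l ∈ (Finset.range (j + 1 + r2 + 1)).erase (j + 1), h l (d l - d (j + 1))) 0 =
      ∑ D ∈ Finset.Ioc 0 N, h 0 (-D) * nestI (List.ofFn fun t : Fin j => fun e => h (j - t.val) (-e)) 0 (D - 1)
        * nestI (List.ofFn fun t : Fin r2 => h (j + 2 + t.val)) 0 (N - D) := by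
  rw [chainS_append, chainS_snoc]
  refine Finset.sum_congr rfl fun D hD => ?_
  have e1 : nestI (List.ofFn fun t : Fin j => fun e => h (j - t.val) (-e)) 0 (D - 1) =
      nestI (List.ofFn fun t : Fin j => fun n => h (t.val + 1) (n - D)) 0 (D - 1) := by
    rw [nestI_reflect _ 0 (D - 1) D]
    congr 1
    · apply List.ext_getElem
      · simp
      · intro n h1 h2
        simp only [List.getElem_reverse, List.getElem_map, List.getElem_ofFn]
        simp only [List.length_ofFn] at h2
        funext e
        simp only [List.length_map, List.length_ofFn]
        rw [show j - (j - 1 - n) = n + 1 by omega, neg_sub]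
    · ring
    · ring
  rw [e1, show (0 : ℤ) = (0 : ℕ → ℤ) 0 from rfl, ← chainS_prod j 0 (D - 1) (fun t n => h (t + 1) (n - D)) 0, mul_right_comm, ← chainS_mul]
  apply chainS_congr
  intro d hd
  have h0 : d 0 = 0 := hd.1 0 le_rfl
  simp only [zero_add, Pi.zero_apply]
  set d' := Function.update d (j + 1) D with hd'
  have e2 : nestI (List.ofFn fun t : Fin r2 => h (j + 2 + t.val)) 0 (N - D) =
     nestI (List.ofFn fun t : Fin r2 => fun n => h (j + 2 + t.val) (n - D)) (d' (j + 1)) N := by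
    rw [nestI_shift _ 0 (N - D) D, List.map_ofFn]
    rw [hd', Function.update_self]
    congr 1
    · ring
    · ring
  rw [e2, ← chainS_prod r2 (j + 1) N (fun t n => h (j + 2 + t) (n - D)) d', mul_right_comm, ← chainS_mul]
  apply chainS_congr
  intro g hg
  have g1 : g (j + 1) = D := by rw [hg.1 _ le_rfl, hd', Function.update_self]
  have g0 : ∀ l, l < j + 1 → g l = d l := fun l hl => by
    rw [hg.1 l (by omega), hd', Function.update_of_ne (by omega)]
  rw [g1]
  have e3 : (Finset.range (j + 1 + r2 + 1)).erase (j + 1) =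
      Finset.range (j + 1) ∪ (Finset.range r2).map (addLeftEmbedding (j + 2)) := by
    ext l
    simp only [Finset.mem_erase, Finset.mem_range, Finset.mem_union, Finset.mem_map, addLeftEmbedding_apply]
    constructor
    · intro hl
      rcases Nat.lt_or_ge l (j + 1) with h | h
      · exact Or.inl h
      · exact Or.inr ⟨l - (j + 2), by omega, by omega⟩
    · rintro (h | ⟨a, ha, rfl⟩) <;> omega
  rw [e3, Finset.prod_union]
  · congr 1
    · rw [Finset.prod_range_succ', g0 0 (by omega), h0, mul_comm, zero_sub]
      congr 1
      refine Finset.prod_congr rfl fun l hl => ?_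
      rw [Finset.mem_range] at hl
      rw [g0 _ (by omega), add_comm 1 l]
    · rw [Finset.prod_map]
      rfl
  · rw [Finset.disjoint_left]
    intro l
    simp only [Finset.mem_range, Finset.mem_map, addLeftEmbedding_apply]
    rintro h ⟨a, ha, rfl⟩; omega

lemma tf_reflect (k : ℕ) (x b : ℂ) (hx : x ≠ 0) (n : ℤ) :
    tf (k, x, b) (1 - n) = (x * (-1) ^ k) * tf (k, x⁻¹, 1 - b) n := by
  simp only [tf]
  rw [zpow_sub₀ hx, zpow_one, inv_zpow]
  have e : (((1 - n : ℤ) : ℂ) + b - 1) = (-1) * ((n : ℂ) + (1 - b) - 1) := by push_cast; ring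
  rw [e, mul_pow]
  have h2 : ((-1 : ℂ) ^ k) * (-1) ^ k = 1 := by rw [← mul_pow]; simp
  have h3 : ((-1 : ℂ) ^ k)⁻¹ = (-1) ^ k := inv_eq_of_mul_eq_one_left h2
  rw [div_eq_mul_inv, div_eq_mul_inv, div_eq_mul_inv, mul_inv, h3]
  ring

lemma single_tendsto (c : ℕ × ℂ × ℂ) (hc : Good c) (h1 : ¬(c.1 = 1 ∧ c.2.1 = 1)) :
    Tendsto (fun N : ℤ => ∑ n ∈ Finset.Ioc 0 N, tf c n) atTop (𝓝 (cmhz [c])) := by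
  have := cmhz_tendsto [c] ⟨by simpa using hc, by simpa using h1⟩
  simpa [nestI_cons] using this

lemma two_sided (X : ℂ) (hXn : ‖X‖ = 1) (hX1 : X ≠ 1) (a : ℂ) (ha : ∀ z : ℤ, a ≠ (z : ℂ)) (i : ℕ) (d : ℤ) :
    Tendsto (fun M : ℕ => ∑ n ∈ Finset.Ioc (-(M : ℤ)) M, X ^ n * (((n : ℂ) + (a + d - 1)) ^ (i + 1))⁻¹) atTop
      (𝓝 (X ^ (-d) * (-X * ((-1 : ℂ) ^ i * lih1 (i + 1) X⁻¹ (1 - a) - X⁻¹ * lih1 (i + 1) X a)))) := by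
  have hX0 : X ≠ 0 := by rintro rfl; simp at hXn
  have t1 := single_tendsto (i + 1, X, a) ⟨by simp, hXn, fun n _ h => ha (1 - n) (by
    simp only at h; push_cast; linear_combination h)⟩ (by simp [hX1])
  have t2 := single_tendsto (i + 1, X⁻¹, 1 - a) ⟨by simp, by simp [hXn], fun n _ h => ha n (by
    simp only at h; linear_combination -h)⟩ (by simp [hX1])
  have u1 : Tendsto (fun M : ℕ => (M : ℤ) + d) atTop atTop :=
    tendsto_atTop_add_const_right _ _ tendsto_natCast_atTop_atTop
  have u2 : Tendsto (fun M : ℕ => (M : ℤ) - d) atTop atTop := by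
    simpa [sub_eq_add_neg] using tendsto_atTop_add_const_right (atTop : Filter ℕ) (-d) (tendsto_natCast_atTop_atTop (R := ℤ))
  have t := (((t2.comp u2).const_mul (X * (-1) ^ (i + 1))).add (t1.comp u1)).const_mul (X ^ (-d))
  have e : X ^ (-d) * (X * (-1) ^ (i + 1) * cmhz [(i + 1, X⁻¹, 1 - a)] + cmhz [(i + 1, X, a)]) =
      X ^ (-d) * (-X * ((-1 : ℂ) ^ i * lih1 (i + 1) X⁻¹ (1 - a) - X⁻¹ * lih1 (i + 1) X a)) := by
    simp only [lih1]
    congr 1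
    field_simp
    ring
  rw [e] at t
  refine t.congr' ?_
  filter_upwards [eventually_ge_atTop d.natAbs] with M hM
  rw [sum_Ioc_shift _ (-(M : ℤ)) M d, sum_Ioc_split _ (by omega : -(M : ℤ) + d ≤ 0), min_eq_left (by omega),
    sum_Ioc_reflect _ (-(M : ℤ) + d) 0 1, mul_add]
  have e0 : ∀ n : ℤ, X ^ (n - d) * ((((n - d : ℤ) : ℂ) + (a + d - 1)) ^ (i + 1))⁻¹ = X ^ (-d) * tf (i + 1, X, a) n := by
    intro n
    simp only [tf]
    rw [sub_eq_add_neg, zpow_add₀ hX0, div_eq_mul_inv]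
    rw [show (((n + -d : ℤ) : ℂ) + (a + d - 1)) = n + a - 1 by push_cast; ring]
    ring
  simp only [e0, tf_reflect _ _ _ hX0, Function.comp]
  simp only [Finset.mul_sum]
  congr 1
  refine Finset.sum_congr ?_ fun n _ => rfl
  congr 1 <;> ring

/-- hypotheses of the theorem -/
structure Hyp (r : ℕ) (k : ℕ → ℕ) (x a : ℕ → ℂ) (X : ℂ) : Prop where
  hk : ∀ i, i ≤ r → 0 < k i
  ha : ∀ i, i ≤ r → ∀ z : ℤ, a i ≠ (z : ℂ)
  hij : ∀ i j, i < j → j ≤ r → ∀ t : ℕ, a j - a i ≠ -((t : ℂ) + 1)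
  hx : ∀ i, i ≤ r → ‖x i‖ = 1
  h0 : ¬(k 0 = 1 ∧ x 0 = 1)
  hr : ¬(k r = 1 ∧ x r = 1)
  hX : X = ∏ i ∈ Finset.range (r + 1), x i
  hX1 : X ≠ 1

lemma Hyp.hx0 {r k x a X} (H : Hyp r k x a X) {i : ℕ} (hi : i ≤ r) : x i ≠ 0 := by
  intro h; have := H.hx i hi; simp [h] at this

lemma Hyp.hXn {r k x a X} (H : Hyp r k x a X) : ‖X‖ = 1 := by
  rw [H.hX, norm_prod]
  exact Finset.prod_eq_one fun i hi => H.hx i (by simpa [Nat.lt_succ_iff] using hi)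

lemma Hyp.hX0 {r k x a X} (H : Hyp r k x a X) : X ≠ 0 := by
  intro h; have := H.hXn; simp [h] at this

/-- truncated sum -/
noncomputable def SS (r : ℕ) (k : ℕ → ℕ) (x a : ℕ → ℂ) (M N : ℕ) : ℂ :=
  ∑ n ∈ Finset.Ioc (-(M : ℤ)) M, tf (k 0, x 0, a 0) n *
    nestI (List.ofFn fun t : Fin r => tf (k (t.val + 1), x (t.val + 1), a (t.val + 1))) n (n + N)

lemma SS_eq (r : ℕ) (k : ℕ → ℕ) (x a : ℕ → ℂ) (M N : ℕ) :
    SS r k x a M N = chainS r 0 N (fun d => ∑ n ∈ Finset.Ioc (-(M : ℤ)) M,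
      ∏ l ∈ Finset.range (r + 1), tf (k l, x l, a l) (n + d l)) 0 := by
  rw [SS, chainS_sum]
  refine Finset.sum_congr rfl fun n _ => ?_
  rw [nestI_shift _ n (n + N) (-n), List.map_ofFn]
  have := chainS_prod r 0 N (fun l e => tf (k (l + 1), x (l + 1), a (l + 1)) (e - -n)) 0
  rw [Pi.zero_apply] at this
  rw [show n + -n = 0 by ring, show n + (N : ℤ) + -n = N by ring]
  simp only [Function.comp_def]
  rw [← this, ← chainS_mul]
  apply chainS_congr
  intro d hd
  have h0 : d 0 = 0 := hd.1 0 le_rfl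
  rw [Finset.prod_range_succ', h0, add_zero, mul_comm]
  congr 1
  refine Finset.prod_congr rfl fun l _ => ?_
  congr 1
  rw [show 0 + 1 + l = l + 1 by ring]; ring

/-- summand -/
noncomputable def hh (k : ℕ → ℕ) (x a : ℕ → ℂ) (j : ℕ) (m : ℕ → ℕ) (l : ℕ) (e : ℤ) : ℂ :=
  ((-1) ^ m l * (Nat.choose (m l + k l - 1) (k l - 1) : ℂ)) *
    (x l ^ e * (((e : ℂ) + a l - a j) ^ (k l + m l))⁻¹)

/-- inner sums -/
noncomputable def QQ (r : ℕ) (k : ℕ → ℕ) (x a : ℕ → ℂ) (j : ℕ) (m : ℕ → ℕ) (N : ℕ) : ℂ :=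
  chainS r 0 N (fun d => ∏ l ∈ (Finset.range (r + 1)).erase j, hh k x a j m l (d l - d j)) 0

/-- the constants -/
noncomputable def Lh (X : ℂ) (i : ℕ) (a : ℂ) : ℂ :=
  (-1 : ℂ) ^ i * lih1 (i + 1) X⁻¹ (1 - a) - X⁻¹ * lih1 (i + 1) X a

lemma IsChn.lt {r : ℕ} {d d' : ℕ → ℤ} (h : IsChn r 0 d d') {l j : ℕ} (hl : l < j) (hj : j ≤ r) : d' l < d' j := by
  induction j with
  | zero => omega
  | succ j ih =>
    have := h.2 j (by omega) (by omega)
    rcases Nat.lt_succ_iff_lt_or_eq.1 hl with h | rfl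
    · exact (ih h (by omega)).trans this
    · exact this

lemma claimB {r k x a X} (H : Hyp r k x a X) (N : ℕ) :
    Tendsto (fun M => SS r k x a M N) atTop (𝓝 (∑ j ∈ Finset.range (r + 1), ∑ i ∈ Finset.range (k j),
      (-X * Lh X i (a j)) * ∑ m ∈ Finset.finsuppAntidiag ((Finset.range (r + 1)).erase j) (k j - 1 - i),
        QQ r k x a j m N)) := by
  simp only [SS_eq]
  have : (∑ j ∈ Finset.range (r + 1), ∑ i ∈ Finset.range (k j),
      (-X * Lh X i (a j)) * ∑ m ∈ Finset.finsuppAntidiag ((Finset.range (r + 1)).erase j) (k j - 1 - i),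
        QQ r k x a j m N) = chainS r 0 N (fun d => ∑ j ∈ Finset.range (r + 1), ∑ i ∈ Finset.range (k j),
      (-X * Lh X i (a j)) * ∑ m ∈ Finset.finsuppAntidiag ((Finset.range (r + 1)).erase j) (k j - 1 - i),
        ∏ l ∈ (Finset.range (r + 1)).erase j, hh k x a j m l (d l - d j)) 0 := by
    rw [chainS_sum]
    refine Finset.sum_congr rfl fun j _ => ?_
    rw [chainS_sum]
    refine Finset.sum_congr rfl fun i _ => ?_
    rw [chainS_mul, chainS_sum]
    rfl
  rw [this]
  apply chainS_tendsto
  intro d hd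
  have hle : ∀ {i}, i ∈ Finset.range (r + 1) → i ≤ r := fun hi => by simpa [Nat.lt_succ_iff] using hi
  set c : ℕ → ℂ := fun l => a l + d l - 1 with hc
  have hcd : ∀ l j, l < j → j ≤ r → c l ≠ c j := by
    intro l j hl hj h
    have h1 := hd.lt hl hj
    apply H.hij l j hl hj (d j - d l - 1).toNat
    have : (((d j - d l - 1).toNat : ℤ) : ℂ) = ((d j - d l - 1 : ℤ) : ℂ) := by
      rw [Int.toNat_of_nonneg (by omega)]
    rw [Int.cast_natCast] at this
    rw [this]
    simp only [hc] at h
    push_cast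
    linear_combination -h
  have key : ∀ n : ℤ, ∏ l ∈ Finset.range (r + 1), tf (k l, x l, a l) (n + d l) =
      (∏ l ∈ Finset.range (r + 1), x l ^ d l) * (X ^ n * ∏ l ∈ Finset.range (r + 1), (((n : ℂ) + c l) ^ k l)⁻¹) := by
    intro n
    rw [H.hX, ← Finset.prod_zpow, ← Finset.prod_mul_distrib, ← Finset.prod_mul_distrib]
    refine Finset.prod_congr rfl fun l hl => ?_
    simp only [tf, hc]
    rw [zpow_add₀ (H.hx0 (hle hl)), div_eq_mul_inv]
    rw [show (((n + d l : ℤ) : ℂ) + a l - 1) = n + (a l + d l - 1) by push_cast; ring]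
    ring
  have pf : ∀ n : ℤ, _ := fun n => partial_fractions (Finset.range (r + 1)) (by simp) k (fun i hi => H.hk i (hle hi)) c
    (by
      intro i hi j hj hne
      rcases lt_or_gt_of_ne hne with h | h
      · exact hcd i j h (hle hj)
      · exact (hcd j i h (hle hi)).symm) (n : ℂ) (by
      intro i hi h
      apply H.ha i (hle hi) (1 - d i - n)
      simp only [hc] at h
      push_cast
      linear_combination h)
  simp only [key, pf]
  have t : Tendsto (fun M : ℕ => ∑ j ∈ Finset.range (r + 1), ∑ i ∈ Finset.range (k j),
      ((∏ l ∈ Finset.range (r + 1), x l ^ d l) * ∑ m ∈ Finset.finsuppAntidiag ((Finset.range (r + 1)).erase j) (k j - 1 - i),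
        ∏ l ∈ (Finset.range (r + 1)).erase j, ((-1) ^ m l * (Nat.choose (m l + k l - 1) (k l - 1) : ℂ) * ((c l - c j) ^ (k l + m l))⁻¹)) *
        ∑ n ∈ Finset.Ioc (-(M : ℤ)) M, X ^ n * (((n : ℂ) + (a j + d j - 1)) ^ (i + 1))⁻¹) atTop (𝓝 _) :=
    tendsto_finsetSum _ fun j hj => tendsto_finsetSum _ fun i _ =>
      (two_sided X H.hXn H.hX1 (a j) (H.ha j (hle hj)) i (d j)).const_mul _
  refine (t.congr fun M => ?_).trans (le_of_eq ?_)
  · simp only [Finset.mul_sum, Finset.sum_mul]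
    symm
    rw [Finset.sum_comm]
    refine Finset.sum_congr rfl fun j _ => ?_
    rw [Finset.sum_comm]
    refine Finset.sum_congr rfl fun i _ => ?_
    refine Finset.sum_congr rfl fun n _ => ?_
    refine Finset.sum_congr rfl fun m _ => ?_
    simp only [hc]
    ring
  · congr 1
    refine Finset.sum_congr rfl fun j hj => ?_
    refine Finset.sum_congr rfl fun i _ => ?_
    have e : (∏ l ∈ Finset.range (r + 1), x l ^ d l) * X ^ (-d j) = ∏ l ∈ (Finset.range (r + 1)).erase j, x l ^ (d l - d j) := by
      rw [H.hX, ← Finset.prod_zpow, ← Finset.prod_mul_distrib, ← Finset.mul_prod_erase _ _ hj]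
      rw [← zpow_add₀ (H.hx0 (hle hj)), add_neg_cancel, zpow_zero, one_mul]
      refine Finset.prod_congr rfl fun l hl => ?_
      rw [← zpow_add₀ (H.hx0 (hle (Finset.mem_of_mem_erase hl))), sub_eq_add_neg]
    rw [show ∀ A B C D : ℂ, A * B * (C * D) = D * ((A * C) * B) by intros; ring, e, Finset.mul_sum]
    congr 1
    refine Finset.sum_congr rfl fun m _ => ?_
    rw [← Finset.prod_mul_distrib]
    refine Finset.prod_congr rfl fun l _ => ?_
    simp only [hh, hc]
    rw [show (((d l - d j : ℤ) : ℂ) + a l - a j) = a l + d l - 1 - (a j + d j - 1) by push_cast; ring]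
    ring

lemma sum_Ioc_range (g : ℤ → ℂ) (N : ℕ) : ∑ n ∈ Finset.Ioc (0 : ℤ) N, g n = ∑ p ∈ Finset.range N, g (p + 1) := by
  induction N with
  | zero => simp
  | succ N ih =>
    rw [Finset.sum_range_succ, ← ih]
    have := sum_Ioc_int_succ g (m := 0) (N := N) (by omega)
    push_cast
    exact this

lemma adm_ofFn (n : ℕ) (c : Fin n → ℕ × ℂ × ℂ) (hg : ∀ t, Good (c t))
    (hl : ∀ h : 0 < n, ¬((c ⟨n - 1, by omega⟩).1 = 1 ∧ (c ⟨n - 1, by omega⟩).2.1 = 1)) : Adm (List.ofFn c) := by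
  refine ⟨fun d hd => ?_, fun d hd => ?_⟩
  · rw [List.mem_ofFn] at hd
    obtain ⟨t, rfl⟩ := hd
    exact hg t
  · rw [List.getLast?_eq_getElem?] at hd
    simp only [List.length_ofFn, Option.mem_def] at hd
    rw [List.getElem?_eq_some_iff] at hd
    obtain ⟨h, rfl⟩ := hd
    simp only [List.length_ofFn] at h
    simp only [List.getElem_ofFn]
    exact hl (by omega)

lemma adm_snoc (K : List (ℕ × ℂ × ℂ)) (c) (hK : ∀ d ∈ K, Good d) (hc : Good c) (h : ¬(c.1 = 1 ∧ c.2.1 = 1)) :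
    Adm (K ++ [c]) := by
  refine ⟨fun d hd => ?_, fun d hd => ?_⟩
  · rw [List.mem_append, List.mem_singleton] at hd
    rcases hd with hd | rfl
    · exact hK d hd
    · exact hc
  · simp at hd
    subst hd
    exact h

lemma ces_conv_list (K1 : List (ℕ × ℂ × ℂ)) (c) (K2) (h1 : Adm (K1 ++ [c])) (h2 : Adm K2) (s : ℕ) :
    CesL (fun N => ∑ D ∈ Finset.Ioc (0 : ℤ) N, tf c D * nestI (K1.map tf) 0 (D - 1) * nestI (K2.map tf) 0 (N - D + s))
      (cmhz (K1 ++ [c]) * cmhz K2) := by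
  have t1 := (cmhz_tendsto _ h1).comp (tendsto_natCast_atTop_atTop (R := ℤ))
  have t2 := ((cmhz_tendsto _ h2).comp (tendsto_natCast_atTop_atTop (R := ℤ))).comp (tendsto_add_atTop_nat s)
  have := cesL_conv _ _ _ _ ?_ t1 t2
  · convert this using 2 with N
    rw [sum_Ioc_range]
    refine Finset.sum_congr rfl fun p hp => ?_
    rw [Finset.mem_range] at hp
    simp only [Function.comp, List.map_append, List.map_cons, List.map_nil, nestI_snoc]
    push_cast
    rw [sum_Ioc_int_succ _ (by omega : (0 : ℤ) ≤ p)]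
    rw [show ((N - 1 - p : ℕ) : ℤ) = N - (p + 1) by omega]
    ring
  · simp [nestI_eq_zero]

lemma nestI_ofFn_const (n : ℕ) (u : Fin n → ℂ) (g : Fin n → ℤ → ℂ) (m N : ℤ) :
    nestI (List.ofFn fun t e => u t * g t e) m N = (∏ t, u t) * nestI (List.ofFn g) m N := by
  have := nestI_const (List.finRange n) u g m N
  rw [List.ofFn_eq_map, List.ofFn_eq_map, this, ← List.ofFn_eq_map, List.prod_ofFn]

lemma hh_pos (k x a) (j : ℕ) (m : ℕ → ℕ) (l : ℕ) (e : ℤ) : hh k x a j m l e =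
    ((-1) ^ m l * (Nat.choose (m l + k l - 1) (k l - 1) : ℂ)) * tf (k l + m l, x l, 1 - a j + a l) e := by
  simp only [hh, tf, div_eq_mul_inv]
  rw [show (e : ℂ) + (1 - a j + a l) - 1 = e + a l - a j by ring]

lemma neg_one_inv (n : ℕ) : ((-1 : ℂ) ^ n)⁻¹ = (-1) ^ n := 
  inv_eq_of_mul_eq_one_left (by rw [← mul_pow]; simp)

lemma hh_neg (k x a) (j : ℕ) (m : ℕ → ℕ) (l : ℕ) (e : ℤ) : hh k x a j m l (-e) =
    ((-1) ^ k l * (Nat.choose (m l + k l - 1) (k l - 1) : ℂ)) * tf (k l + m l, (x l)⁻¹, 1 + a j - a l) e := by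
  simp only [hh, tf, div_eq_mul_inv]
  rw [show (e : ℂ) + (1 + a j - a l) - 1 = e + a j - a l by ring, 
   show ((-e : ℤ) : ℂ) + a l - a j = (-1) * (e + a j - a l) by push_cast; ring, mul_pow, mul_inv, neg_one_inv,
   inv_zpow, zpow_neg, pow_add]
  have : ((-1 : ℂ) ^ m l) * (-1) ^ m l = 1 := by rw [← mul_pow]; simp
  linear_combination ((Nat.choose (m l + k l - 1) (k l - 1) : ℂ)) * ((x l ^ e)⁻¹ * ((-1 : ℂ) ^ k l) * (((e : ℂ) + a j - a l) ^ (k l + m l))⁻¹) * this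

lemma Hyp.good_pos {r k x a X} (H : Hyp r k x a X) {j l m : ℕ} (h : j < l) (hl : l ≤ r) :
    Good (k l + m, x l, 1 - a j + a l) := by
  refine ⟨by have := H.hk l hl; simp only; omega, H.hx l hl, fun n hn h' => ?_⟩
  apply H.hij j l h hl (n - 1).toNat
  have : (((n - 1).toNat : ℤ) : ℂ) = ((n - 1 : ℤ) : ℂ) := by rw [Int.toNat_of_nonneg (by omega)]
  rw [Int.cast_natCast] at this
  rw [this]
  simp only at h'
  push_cast
  linear_combination h'

lemma Hyp.good_neg {r k x a X} (H : Hyp r k x a X) {j l m : ℕ} (h : l < j) (hj : j ≤ r) :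
    Good (k l + m, (x l)⁻¹, 1 + a j - a l) := by
  refine ⟨by have := H.hk l (by omega); simp only; omega, by simp [H.hx l (by omega)], fun n hn h' => ?_⟩
  apply H.hij l j h hj (n - 1).toNat
  have : (((n - 1).toNat : ℤ) : ℂ) = ((n - 1 : ℤ) : ℂ) := by rw [Int.toNat_of_nonneg (by omega)]
  rw [Int.cast_natCast] at this
  rw [this]
  simp only at h'
  push_cast
  linear_combination h'

lemma Hyp.adm_pos {r k x a X} (H : Hyp r k x a X) (j r2 : ℕ) (hr2 : j + r2 = r) (m : ℕ → ℕ) :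
    Adm (List.ofFn fun t : Fin r2 => (k (j + 1 + t.val) + m (j + 1 + t.val), x (j + 1 + t.val), 1 - a j + a (j + 1 + t.val))) := by
  apply adm_ofFn
  · intro t
    exact H.good_pos (by omega) (by omega)
  · intro h
    simp only
    rw [show j + 1 + (r2 - 1) = r by omega]
    have := H.hk r le_rfl
    rintro ⟨h1, h2⟩
    exact H.hr ⟨by omega, h2⟩

lemma cesQ_zero {r k x a X} (H : Hyp r k x a X) (m : ℕ → ℕ) :
    CesL (QQ r k x a 0 m) ((∏ l : Fin r, (-1) ^ m (l.val + 1) * (Nat.choose (m (l.val + 1) + k (l.val + 1) - 1) (k (l.val + 1) - 1) : ℂ)) *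
      cmhz (List.ofFn fun l : Fin r => (k (l.val + 1) + m (l.val + 1), x (l.val + 1), 1 - a 0 + a (l.val + 1)))) := by
  have hA : Adm (List.ofFn fun l : Fin r => (k (l.val + 1) + m (l.val + 1), x (l.val + 1), 1 - a 0 + a (l.val + 1))) := by
    have h := H.adm_pos 0 r (by omega) m
    have e : ∀ t, 0 + 1 + t = t + 1 := fun t => by omega
    simp only [e] at h
    exact h
  have t := (((cmhz_tendsto _ hA).comp (tendsto_natCast_atTop_atTop (R := ℤ))).const_mul
    (∏ l : Fin r, (-1) ^ m (l.val + 1) * (Nat.choose (m (l.val + 1) + k (l.val + 1) - 1) (k (l.val + 1) - 1) : ℂ)))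
  refine CesL.of_tendsto (t.congr fun N => ?_)
  simp only [QQ, Q_zero]
  rw [Function.comp, List.map_ofFn, ← nestI_ofFn_const]
  congr 2
  funext t e
  rw [hh_pos]; rfl

lemma cesQ_succ {r k x a X} (H : Hyp r k x a X) (m : ℕ → ℕ) (j r2 : ℕ) (hr2 : j + 1 + r2 = r) :
    CesL (QQ r k x a (j + 1) m) ((((-1) ^ k 0 * (Nat.choose (m 0 + k 0 - 1) (k 0 - 1) : ℂ)) *
      (∏ t : Fin j, ((-1) ^ k (j - t.val) * (Nat.choose (m (j - t.val) + k (j - t.val) - 1) (k (j - t.val) - 1) : ℂ))) *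
      (∏ t : Fin r2, ((-1) ^ m (j + 2 + t.val) * (Nat.choose (m (j + 2 + t.val) + k (j + 2 + t.val) - 1) (k (j + 2 + t.val) - 1) : ℂ)))) *
      (cmhz ((List.ofFn fun t : Fin j => (k (j - t.val) + m (j - t.val), (x (j - t.val))⁻¹, 1 + a (j + 1) - a (j - t.val))) ++
        [(k 0 + m 0, (x 0)⁻¹, 1 + a (j + 1) - a 0)]) *
       cmhz (List.ofFn fun t : Fin r2 => (k (j + 2 + t.val) + m (j + 2 + t.val), x (j + 2 + t.val), 1 - a (j + 1) + a (j + 2 + t.val))))) := by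
  have hA : Adm ((List.ofFn fun t : Fin j => (k (j - t.val) + m (j - t.val), (x (j - t.val))⁻¹, 1 + a (j + 1) - a (j - t.val))) ++
        [(k 0 + m 0, (x 0)⁻¹, 1 + a (j + 1) - a 0)]) := by
    apply adm_snoc
    · intro d hd
      rw [List.mem_ofFn] at hd
      obtain ⟨t, rfl⟩ := hd
      exact H.good_neg (by omega) (by omega)
    · exact H.good_neg (by omega) (by omega)
    · have := H.hk 0 (by omega)
      rintro ⟨h1, h2⟩
      simp only at h1 h2
      exact H.h0 ⟨by omega, by simpa using h2⟩
  have hB := H.adm_pos (j + 1) r2 hr2 m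
  have t := (ces_conv_list _ _ _ hA hB 0).const_mul (((-1) ^ k 0 * (Nat.choose (m 0 + k 0 - 1) (k 0 - 1) : ℂ)) *
      (∏ t : Fin j, ((-1) ^ k (j - t.val) * (Nat.choose (m (j - t.val) + k (j - t.val) - 1) (k (j - t.val) - 1) : ℂ))) *
      (∏ t : Fin r2, ((-1) ^ m (j + 2 + t.val) * (Nat.choose (m (j + 2 + t.val) + k (j + 2 + t.val) - 1) (k (j + 2 + t.val) - 1) : ℂ))))
  convert t using 2 with N
  subst hr2
  rw [QQ, Q_succ, Finset.mul_sum]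
  refine Finset.sum_congr rfl fun D hD => ?_
  have e1 : (List.ofFn fun t : Fin j => fun e => hh k x a (j + 1) m (j - t.val) (-e)) =
    List.ofFn fun (t : Fin j) e => ((-1) ^ k (j - t.val) * (Nat.choose (m (j - t.val) + k (j - t.val) - 1) (k (j - t.val) - 1) : ℂ)) *
      tf (k (j - t.val) + m (j - t.val), (x (j - t.val))⁻¹, 1 + a (j + 1) - a (j - t.val)) e := by
    congr 1; funext t e; rw [hh_neg]
  have e2 : (List.ofFn fun t : Fin r2 => hh k x a (j + 1) m (j + 2 + t.val)) =
    List.ofFn fun (t : Fin r2) e => ((-1) ^ m (j + 2 + t.val) * (Nat.choose (m (j + 2 + t.val) + k (j + 2 + t.val) - 1) (k (j + 2 + t.val) - 1) : ℂ)) *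
      tf (k (j + 2 + t.val) + m (j + 2 + t.val), x (j + 2 + t.val), 1 - a (j + 1) + a (j + 2 + t.val)) e := by
    congr 1; funext t e; rw [hh_pos]
  rw [e1, e2, nestI_ofFn_const, nestI_ofFn_const, hh_neg, List.map_ofFn, List.map_ofFn]
  simp only [Function.comp_def, Nat.cast_zero, add_zero]
  ring

/-- reflected triple -/
noncomputable def rf (c : ℕ × ℂ × ℂ) : ℕ × ℂ × ℂ := (c.1, c.2.1⁻¹, 1 - c.2.2)
/-- constant in the reflection -/
noncomputable def uc (c : ℕ × ℂ × ℂ) : ℂ := c.2.1 * (-1) ^ c.1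

lemma tf_rf (c : ℕ × ℂ × ℂ) (hc : c.2.1 ≠ 0) (n : ℤ) : tf c (1 - n) = uc c * tf (rf c) n :=
  tf_reflect c.1 c.2.1 c.2.2 hc n

lemma nestI_rf (K : List (ℕ × ℂ × ℂ)) (hK : ∀ c ∈ K, c.2.1 ≠ 0) (m N : ℤ) :
    nestI (K.map tf) m N = (K.map uc).prod * nestI ((K.map rf).reverse.map tf) (-N) (-m) := by
  rw [nestI_reflect _ m N 1]
  have : (K.map tf).map (fun f n => f (1 - n)) = K.map fun c n => uc c * tf (rf c) n := by
    rw [List.map_map]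
    apply List.map_congr_left
    intro c hc
    funext n
    exact tf_rf c (hK c hc) n
  rw [this, ← List.map_reverse, nestI_const, List.map_reverse, List.prod_reverse, ← List.map_reverse, List.map_map]
  congr 2 <;> ring

lemma cmhz_nil : cmhz [] = 1 := by
  have := cmhz_tendsto [] ⟨by simp, by simp⟩
  simp only [List.map_nil, nestI_nil] at this
  exact tendsto_nhds_unique this tendsto_const_nhds

lemma Adm.drop {K : List (ℕ × ℂ × ℂ)} (h : Adm K) (i : ℕ) : Adm (K.drop i) := by
  refine ⟨fun c hc => h.1 c (List.mem_of_mem_drop hc), fun c hc => h.2 c ?_⟩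
  rw [List.getLast?_drop] at hc
  split_ifs at hc with h'
  · simp at hc
  · exact hc

lemma partP (c : ℕ × ℂ × ℂ) (hc : Good c) (K : List (ℕ × ℂ × ℂ)) (hK : Adm K) (hne : K ≠ []) (N : ℕ) :
    Tendsto (fun M : ℕ => ∑ n ∈ Finset.Ioc (0 : ℤ) M, tf c n * nestI (K.map tf) n (n + N)) atTop
      (𝓝 (∑' s : ℕ, tf c (0 + 1 + s) * nestI (K.map tf) (0 + 1 + s) (0 + 1 + s + N))) := by
  have := tannery (F := (atTop : Filter ℕ)) c hc K hK hne 0 le_rfl (fun M n => if n ≤ M then n + N else n)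
    (fun n => nestI (K.map tf) n (n + N)) ?_
  · refine this.congr fun M => ?_
    symm
    apply sum_Ioc_tsum _ 0 M (fun n => tf c n * nestI (K.map tf) n (if n ≤ M then n + N else n))
    · intro n _ hn
      rw [if_pos hn]
    · intro n _ hn
      rw [if_neg (by omega), nestI_eq_zero (by simpa using hne) le_rfl, mul_zero]
  · intro n hn
    refine tendsto_const_nhds.congr' ?_
    filter_upwards [eventually_ge_atTop n.toNat] with M hM
    rw [if_pos (by omega)]

lemma partZ (c : ℕ × ℂ × ℂ) (hc : Good c) (L : List (ℕ × ℂ × ℂ)) (c0) (hK : Adm (L ++ [c0])) (N : ℕ) :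
    Tendsto (fun M : ℕ => ∑ p ∈ Finset.Ioc (0 : ℤ) M, tf c0 p * nestI ((c :: L).map tf) (max 0 (p - 1 - N)) (p - 1)) atTop
      (𝓝 (∑' s : ℕ, tf c (0 + 1 + s) * nestI ((L ++ [c0]).map tf) (0 + 1 + s) (0 + 1 + s + N))) := by
  have := tannery (F := (atTop : Filter ℕ)) c hc _ hK (by simp) 0 le_rfl (fun M n => min M (n + N))
    (fun n => nestI ((L ++ [c0]).map tf) n (n + N)) ?_
  · refine this.congr fun M => ?_
    symm
    have e := sum_Ioc_tsum _ 0 M (fun n => tf c n * nestI ((L ++ [c0]).map tf) n (min M (n + N))) (fun n _ _ => rfl) ?_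
    · rw [← e]
      simp only [List.map_append, List.map_cons, List.map_nil, nestI_snoc, nestI_cons, Finset.mul_sum]
      rw [Finset.sum_comm' (s' := fun q => Finset.Ioc q (min (M : ℤ) (q + N))) (t' := Finset.Ioc (0 : ℤ) M)]
      · refine Finset.sum_congr rfl fun q _ => Finset.sum_congr rfl fun p _ => by ring
      · intro p q
        simp only [Finset.mem_Ioc]
        omega
    · intro n _ hn
      rw [nestI_eq_zero (by simp) (by omega), mul_zero]
  · intro n hn
    refine tendsto_const_nhds.congr' ?_
    filter_upwards [eventually_ge_atTop (n + N).toNat] with M hM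
    rw [min_eq_right (by omega)]

lemma claimA (c0 : ℕ × ℂ × ℂ) (K : List (ℕ × ℂ × ℂ)) (hA : Adm (c0 :: K)) (hne : K ≠ [])
    (hg : ∀ c ∈ c0 :: K, Good (rf c)) (h0 : ¬(c0.1 = 1 ∧ c0.2.1 = 1)) : ∃ E : ℕ → ℂ,
    (∀ N : ℕ, Tendsto (fun M : ℕ => ∑ n ∈ Finset.Ioc (-(M : ℤ)) M, tf c0 n * nestI (K.map tf) n (n + N)) atTop (𝓝 (E N))) ∧
    CesL E (cmhz (c0 :: K) + ∑ i ∈ Finset.range (K.length + 1), (uc c0 * ((K.take i).map uc).prod) *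
      (cmhz (((K.take i).map rf).reverse ++ [rf c0]) * cmhz (K.drop i))) := by
  have hAK : Adm K := by simpa using hA.drop 1
  have hx0 : ∀ c ∈ c0 :: K, c.2.1 ≠ 0 := by
    intro c hc h
    have := (hA.1 c hc).2.1
    simp [h] at this
  have hR : ∀ i, Adm (((K.take i).map rf).reverse ++ [rf c0]) := by
    intro i
    apply adm_snoc
    · intro d hd
      rw [List.mem_reverse, List.mem_map] at hd
      obtain ⟨c, hc, rfl⟩ := hd
      exact hg c (List.mem_cons_of_mem _ (List.mem_of_mem_take hc))
    · exact hg c0 (by simp)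
    · simpa [rf] using h0
  -- decomposition of K reversed
  obtain ⟨c, L, hcL⟩ : ∃ c L, (K.map rf).reverse = c :: L := by
    cases h : (K.map rf).reverse with
    | nil => simp at h; exact absurd h hne
    | cons c L => exact ⟨c, L, rfl⟩
  have hRK := hR K.length
  rw [List.take_length, hcL, List.cons_append] at hRK
  have hgc : Good c := hRK.1 c (by simp)
  have hRL : Adm (L ++ [rf c0]) := by simpa using hRK.drop 1
  set P : ℕ → ℂ := fun N => ∑' s : ℕ, tf c0 (0 + 1 + s) * nestI (K.map tf) (0 + 1 + s) (0 + 1 + s + N) with hP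
  set Z : ℕ → ℂ := fun N => (uc c0 * (K.map uc).prod) * ∑' s : ℕ, tf c (0 + 1 + s) * nestI ((L ++ [rf c0]).map tf) (0 + 1 + s) (0 + 1 + s + N) with hZ
  set C : ℕ → ℕ → ℂ := fun i N => (uc c0 * ((K.take i).map uc).prod) * 
    ∑ D ∈ Finset.Ioc (0 : ℤ) N, tf (rf c0) D * nestI (((K.take i).map rf).reverse.map tf) 0 (D - 1) * nestI ((K.drop i).map tf) 0 (N - D + (1 : ℕ)) with hC
  refine ⟨fun N => P N + (∑ i ∈ Finset.range K.length, C i N + Z N), fun N => ?_, ?_⟩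
  · have tP := partP c0 (hA.1 c0 (by simp)) K hAK hne N
    have tZ := (partZ c hgc L (rf c0) hRL N).const_mul (uc c0 * (K.map uc).prod)
    have t := tP.add ((tendsto_const_nhds (x := ∑ i ∈ Finset.range K.length, C i N)).add tZ)
    refine t.congr' ?_
    filter_upwards [eventually_ge_atTop N] with M hM
    rw [sum_Ioc_split _ (by omega : -(M : ℤ) ≤ 0), min_eq_left (by omega), add_comm]
    congr 1
    have e : ∀ n ∈ Finset.Ioc (-(M : ℤ)) 0, tf c0 n * nestI (K.map tf) n (n + N) =
       ∑ i ∈ Finset.range K.length, tf c0 n * (nestI ((K.take i).map tf) n (min 0 (n + N)) * nestI ((K.drop i).map tf) 0 (n + N)) +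
        tf c0 n * nestI (K.map tf) n (min 0 (n + N)) := by
      intro n hn
      rw [Finset.mem_Ioc] at hn
      rw [nestI_split _ hn.2, Finset.sum_range_succ, mul_add, Finset.mul_sum]
      simp only [List.length_map, List.map_take, List.map_drop]
      congr 2
      rw [List.take_of_length_le (by simp), List.drop_of_length_le (by simp), nestI_nil, mul_one]
    rw [Finset.sum_congr rfl e, Finset.sum_add_distrib, Finset.sum_comm]
    congr 1
    · refine Finset.sum_congr rfl fun i hi => ?_
      rw [Finset.mem_range] at hi
      have hd : (K.drop i).map tf ≠ [] := by simp; omega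
      have e2 : ∑ n ∈ Finset.Ioc (-(M : ℤ)) 0, tf c0 n * (nestI ((K.take i).map tf) n (min 0 (n + N)) * nestI ((K.drop i).map tf) 0 (n + N)) =
          ∑ n ∈ Finset.Ioc (-(N : ℤ)) 0, tf c0 n * (nestI ((K.take i).map tf) n (min 0 (n + N)) * nestI ((K.drop i).map tf) 0 (n + N)) := by
        symm
        apply Finset.sum_subset
        · intro n; simp only [Finset.mem_Ioc]; omega
        · intro n h1 h2
          simp only [Finset.mem_Ioc] at h1 h2
          rw [nestI_eq_zero hd (by omega), mul_zero, mul_zero]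
      rw [e2, sum_Ioc_reflect _ (-(N : ℤ)) 0 1, hC]
      simp only [Finset.mul_sum]
      refine Finset.sum_congr (by congr 1 <;> ring) fun p hp => ?_
      rw [Finset.mem_Ioc] at hp
      rw [tf_rf c0 (hx0 c0 (by simp)), nestI_rf (K.take i) (fun c hc => hx0 c (List.mem_cons_of_mem _ (List.mem_of_mem_take hc))),
        min_eq_left (by omega)]
      rw [show -(1 - p) = p - 1 by ring, show 1 - p + (N : ℤ) = N - p + (1 : ℕ) by push_cast; ring, neg_zero]
      ring
    · rw [sum_Ioc_reflect _ (-(M : ℤ)) 0 1, ← hcL]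
      simp only [Finset.mul_sum]
      refine Finset.sum_congr (by congr 1 <;> ring) fun p hp => ?_
      rw [Finset.mem_Ioc] at hp
      rw [tf_rf c0 (hx0 c0 (by simp)), nestI_rf K (fun c hc => hx0 c (List.mem_cons_of_mem _ hc))]
      rw [show -(1 - p) = p - 1 by ring, show -(min 0 (1 - p + (N : ℤ))) = max 0 (p - 1 - N) by omega]
      ring
  · apply CesL.add
    · exact CesL.of_tendsto (cmhz_cons_tendsto c0 K hA hne)
    · rw [Finset.sum_range_succ]
      apply CesL.add
      · apply CesL.sum
        intro i hi
        exact (ces_conv_list _ _ _ (hR i) (hAK.drop i) 1).const_mul _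
      · rw [List.take_length, List.drop_length, cmhz_nil, mul_one, hcL, List.cons_append]
        exact (CesL.of_tendsto (cmhz_cons_tendsto c _ hRK (by simp))).const_mul _

/-- extension of a tuple by a zeroth value -/
noncomputable def ext0 {r : ℕ} (v : ℕ) (g : Fin r → ℕ) : ℕ →₀ ℕ :=
  Finsupp.onFinset (Finset.range (r + 1)) (fun n => if n = 0 then v else if h : n - 1 < r then g ⟨n - 1, h⟩ else 0) (by
    intro n hn
    rw [Finset.mem_range]
    by_contra h
    apply hn
    rw [if_neg (by omega), dif_neg (by omega)])

lemma ext0_zero {r : ℕ} (v : ℕ) (g : Fin r → ℕ) : ext0 v g 0 = v := rfl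

lemma ext0_succ {r : ℕ} (v : ℕ) (g : Fin r → ℕ) (l : ℕ) (hl : l < r) : ext0 v g (l + 1) = g ⟨l, hl⟩ := by
  simp [ext0, hl]

lemma ext0_big {r : ℕ} (v : ℕ) (g : Fin r → ℕ) (l : ℕ) (hl : r < l) : ext0 v g l = 0 := by
  simp only [ext0, Finsupp.onFinset_apply]
  rw [if_neg (by omega), dif_neg (by omega)]

lemma ext0_eta {r : ℕ} (f : ℕ →₀ ℕ) (hf : ∀ l, r < l → f l = 0) : ext0 (f 0) (fun l : Fin r => f (l.val + 1)) = f := by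
  ext l
  rcases l with _ | l
  · rfl
  · rcases Nat.lt_or_ge l r with h | h
    · rw [ext0_succ _ _ _ h]
    · rw [ext0_big _ _ _ (by omega), hf _ (by omega)]

lemma mem_fa {r : ℕ} (s : Finset ℕ) (hs : s ⊆ Finset.range (r + 1)) (n : ℕ) (f : ℕ →₀ ℕ) :
    f ∈ Finset.finsuppAntidiag s n ↔ (f 0 + ∑ l : Fin r, f (l.val + 1) = n ∧ ∀ l, l ∉ s → f l = 0) := by
  rw [Finset.mem_finsuppAntidiag]
  have h1 : f.support ⊆ s ↔ ∀ l, l ∉ s → f l = 0 := by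
    rw [Finset.subset_iff]
    refine forall_congr' fun l => ?_
    rw [Finsupp.mem_support_iff]
    tauto
  rw [h1]
  refine and_congr_left fun h => ?_
  rw [Finset.sum_subset hs (fun l _ hl => h l hl), Finset.sum_range_succ', Finset.sum_range, add_comm]

lemma reindex0 (r n : ℕ) (F : (ℕ →₀ ℕ) → ℂ) :
    ∑ m ∈ Finset.finsuppAntidiag ((Finset.range (r + 1)).erase 0) n, F m =
      ∑ g ∈ Finset.Nat.antidiagonalTuple r n, F (ext0 0 g) := by
  have hs : (Finset.range (r + 1)).erase 0 ⊆ Finset.range (r + 1) := Finset.erase_subset _ _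
  refine Finset.sum_nbij' (fun f => fun l : Fin r => f (l.val + 1)) (fun g => ext0 0 g) ?_ ?_ ?_ ?_ ?_
  · intro f hf
    rw [mem_fa _ hs] at hf
    have := hf.2 0 (by simp)
    rw [Finset.Nat.mem_antidiagonalTuple]
    omega
  · intro g hg
    rw [Finset.Nat.mem_antidiagonalTuple] at hg
    rw [mem_fa _ hs]
    refine ⟨?_, fun l hl => ?_⟩
    · rw [ext0_zero, zero_add, ← hg]
      exact Finset.sum_congr rfl fun l _ => ext0_succ _ _ _ l.isLt
    · rcases l with _ | l
      · rfl
      · apply ext0_big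
        simp at hl; omega
  · intro f hf
    rw [mem_fa _ hs] at hf
    have := hf.2 0 (by simp)
    conv_rhs => rw [← ext0_eta (r := r) f (fun l hl => hf.2 l (by simp; omega))]
    rw [this]
  · intro g hg
    funext l
    exact ext0_succ _ _ _ l.isLt
  · intro f hf
    rw [mem_fa _ hs] at hf
    have := hf.2 0 (by simp)
    congr 1
    conv_lhs => rw [← ext0_eta (r := r) f (fun l hl => hf.2 l (by simp; omega))]
    rw [this]

lemma reindexS (r n : ℕ) (j : Fin r) (F : (ℕ →₀ ℕ) → ℂ) :
    ∑ m ∈ Finset.finsuppAntidiag ((Finset.range (r + 1)).erase (j.val + 1)) n, F m =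
      ∑ m ∈ Finset.range (n + 1), ∑ g ∈ (Finset.Nat.antidiagonalTuple r m).filter (fun mm => mm j = 0), F (ext0 (n - m) g) := by
  have hs : (Finset.range (r + 1)).erase (j.val + 1) ⊆ Finset.range (r + 1) := Finset.erase_subset _ _
  rw [Finset.sum_sigma']
  refine Finset.sum_nbij' (fun f => ⟨∑ l : Fin r, f (l.val + 1), fun l : Fin r => f (l.val + 1)⟩)
    (fun p => ext0 (n - p.1) p.2) ?_ ?_ ?_ ?_ ?_
  · intro f hf
    rw [mem_fa _ hs] at hf
    simp only [Finset.mem_sigma, Finset.mem_filter, Finset.Nat.mem_antidiagonalTuple, Finset.mem_range]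
    refine ⟨by omega, trivial, hf.2 _ (by simp)⟩
  · rintro ⟨m, g⟩ hg
    simp only [Finset.mem_sigma, Finset.mem_filter, Finset.Nat.mem_antidiagonalTuple, Finset.mem_range] at hg
    rw [mem_fa _ hs]
    refine ⟨?_, fun l hl => ?_⟩
    · rw [ext0_zero]
      have : ∑ l : Fin r, ext0 (n - m) g (l.val + 1) = m := by
        rw [← hg.2.1]
        exact Finset.sum_congr rfl fun l _ => ext0_succ _ _ _ l.isLt
      simp only [this]; omega
    · by_cases h : l = j.val + 1
      · rw [h, ext0_succ _ _ _ j.isLt]; exact hg.2.2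
      · apply ext0_big
        simp [h] at hl; omega
  · intro f hf
    rw [mem_fa _ hs] at hf
    conv_rhs => rw [← ext0_eta (r := r) f (fun l hl => hf.2 l (by simp; omega))]
    congr 1
    simp only; omega
  · rintro ⟨m, g⟩ hg
    simp only [Finset.mem_sigma, Finset.mem_filter, Finset.Nat.mem_antidiagonalTuple, Finset.mem_range] at hg
    have : (fun l : Fin r => ext0 (n - m) g (l.val + 1)) = g := by
      funext l
      exact ext0_succ _ _ _ l.isLt
    have h2 : ∑ l : Fin r, ext0 (n - m) g (l.val + 1) = m := by
      rw [← hg.2.1]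
      exact Finset.sum_congr rfl fun l _ => ext0_succ _ _ _ l.isLt
    simp only [this, h2]
  · intro f hf
    rw [mem_fa _ hs] at hf
    congr 1
    conv_lhs => rw [← ext0_eta (r := r) f (fun l hl => hf.2 l (by simp; omega))]
    congr 1
    simp only; omega

lemma prod_erase_fin (r j r2 : ℕ) (h : j + 1 + r2 = r) (jj : Fin r) (hj : jj.val = j) (G : ℕ → ℂ) :
    ∏ l ∈ Finset.univ.erase jj, G l.val = (∏ t : Fin j, G (j - 1 - t.val)) * ∏ t : Fin r2, G (j + 1 + t.val) := by
  rw [← Finset.prod_range (fun t => G (j - 1 - t)), ← Finset.prod_range (fun t => G (j + 1 + t)),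
    Finset.prod_range_reflect]
  have e : ∏ l ∈ Finset.univ.erase jj, G l.val = ∏ l ∈ (Finset.univ.erase jj).map Fin.valEmbedding, G l := by
    rw [Finset.prod_map]; rfl
  have e3 : (Finset.univ.erase jj).map Fin.valEmbedding =
      Finset.range j ∪ (Finset.range r2).map (addLeftEmbedding (j + 1)) := by
    ext l
    simp only [Finset.mem_erase, Finset.mem_range, Finset.mem_union, Finset.mem_map, addLeftEmbedding_apply,
      Finset.mem_univ, and_true, Fin.valEmbedding_apply]
    constructor
    · rintro ⟨t, ht, rfl⟩
      have : t.val ≠ j := fun h' => ht (Fin.ext (by omega))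
      have := t.isLt
      rcases Nat.lt_or_ge t.val j with h | h
      · exact Or.inl h
      · exact Or.inr ⟨t.val - (j + 1), by omega, by omega⟩
    · rintro (h | ⟨b, hb, rfl⟩)
      · exact ⟨⟨l, by omega⟩, fun h' => by rw [← h'] at hj; simp at hj; omega, rfl⟩
      · exact ⟨⟨j + 1 + b, by omega⟩, fun h' => by rw [← h'] at hj; simp at hj; omega, rfl⟩
  rw [e, e3, Finset.prod_union, Finset.prod_map]
  · rfl
  · rw [Finset.disjoint_left]
    intro l
    simp only [Finset.mem_range, Finset.mem_map, addLeftEmbedding_apply]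
    rintro h ⟨a, ha, rfl⟩; omega

lemma sum_filter_fin (r j r2 : ℕ) (h : j + 1 + r2 = r) (jj : Fin r) (hj : jj.val = j) (G : ℕ → ℕ) :
    ∑ l ∈ Finset.univ.filter (fun l => jj < l), G l.val = ∑ t : Fin r2, G (j + 1 + t.val) := by
  rw [← Finset.sum_range (fun t => G (j + 1 + t))]
  have e : ∑ l ∈ Finset.univ.filter (fun l => jj < l), G l.val = ∑ l ∈ (Finset.univ.filter (fun l => jj < l)).map Fin.valEmbedding, G l := by
    rw [Finset.sum_map]; rfl
  have e3 : (Finset.univ.filter (fun l => jj < l)).map Fin.valEmbedding =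
      (Finset.range r2).map (addLeftEmbedding (j + 1)) := by
    ext l
    simp only [Finset.mem_filter, Finset.mem_range, Finset.mem_map, addLeftEmbedding_apply,
      Finset.mem_univ, true_and, Fin.valEmbedding_apply, Fin.lt_def]
    constructor
    · rintro ⟨t, ht, rfl⟩
      have := t.isLt
      exact ⟨t.val - (j + 1), by omega, by omega⟩
    · rintro ⟨b, hb, rfl⟩
      exact ⟨⟨j + 1 + b, by omega⟩, by simp only; omega, rfl⟩
  rw [e, e3, Finset.sum_map]
  rfl

lemma sym_zero (k : ℕ) (hk : 0 < k) (x a : ℂ) :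
    x⁻¹ * cmhz [(k, x, a)] + (-1) ^ k * cmhz [(k, x⁻¹, 1 - a)] +
      ((-1 : ℂ) ^ (k - 1) * lih1 (k - 1 + 1) x⁻¹ (1 - a) - x⁻¹ * lih1 (k - 1 + 1) x a) = 0 := by
  obtain ⟨q, rfl⟩ : ∃ q, k = q + 1 := ⟨k - 1, by omega⟩
  simp only [lih1, Nat.add_sub_cancel]
  ring

/-- the list of triples with index at least one -/
noncomputable def KK (r : ℕ) (k : ℕ → ℕ) (x a : ℕ → ℂ) : List (ℕ × ℂ × ℂ) :=
  List.ofFn fun t : Fin r => (k (t.val + 1), x (t.val + 1), a (t.val + 1))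

lemma KK_cons (r : ℕ) (k : ℕ → ℕ) (x a : ℕ → ℂ) :
    (List.ofFn fun i : Fin (r + 1) => (k i.val, x i.val, a i.val)) = (k 0, x 0, a 0) :: KK r k x a := by
  rw [List.ofFn_succ]; rfl

lemma KK_drop (r : ℕ) (k : ℕ → ℕ) (x a : ℕ → ℂ) (j : ℕ) :
    (KK r k x a).drop j = List.ofFn fun t : Fin (r - j) => (k (j + 1 + t.val), x (j + 1 + t.val), a (j + 1 + t.val)) := by
  apply List.ext_getElem
  · simp [KK]
  · intro n h1 h2
    simp only [KK, List.getElem_drop, List.getElem_ofFn]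
    rw [show j + n + 1 = j + 1 + n by omega]

lemma KK_take (r : ℕ) (k : ℕ → ℕ) (x a : ℕ → ℂ) (j : ℕ) (hj : j ≤ r) :
    (((KK r k x a).take j).map rf).reverse ++ [rf (k 0, x 0, a 0)] =
      List.ofFn fun t : Fin (j + 1) => (k (j - t.val), (x (j - t.val))⁻¹, 1 - a (j - t.val)) := by
  apply List.ext_getElem
  · simp [KK, hj]
  · intro n h1 h2
    simp only [List.length_ofFn] at h2
    rw [List.getElem_append]
    simp only [List.getElem_ofFn]
    split_ifs with h
    · simp only [KK, List.length_reverse, List.length_map, List.length_take, List.length_ofFn] at h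
      simp only [KK, List.getElem_reverse, List.getElem_map, List.getElem_take, List.getElem_ofFn, rf,
        List.length_map, List.length_take, List.length_ofFn]
      rw [show min j r - 1 - n + 1 = j - n by omega]
    · simp only [KK, List.length_reverse, List.length_map, List.length_take, List.length_ofFn] at h
      simp only [List.getElem_singleton, rf]
      rw [show j - n = 0 by omega]

lemma KK_prod (r : ℕ) (k : ℕ → ℕ) (x a : ℕ → ℂ) (j : ℕ) (hj : j ≤ r) :
    uc (k 0, x 0, a 0) * (((KK r k x a).take j).map uc).prod =
      (-1) ^ (∑ i ∈ Finset.range (j + 1), k i) * ∏ i ∈ Finset.range (j + 1), x i := by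
  have e : ((KK r k x a).take j).map uc = List.ofFn fun t : Fin j => uc (k (t.val + 1), x (t.val + 1), a (t.val + 1)) := by
    apply List.ext_getElem
    · simp [KK, hj]
    · intro n h1 h2
      simp only [KK, List.getElem_map, List.getElem_take, List.getElem_ofFn]
  rw [e, List.prod_ofFn, ← Finset.prod_range (fun t => uc (k (t + 1), x (t + 1), a (t + 1))), mul_comm,
    ← Finset.prod_range_succ' (fun t => uc (k t, x t, a t))]
  simp only [uc]
  rw [Finset.prod_mul_distrib, Finset.prod_pow_eq_pow_sum, mul_comm]

lemma identity {r k x a X} (H : Hyp r k x a X) (hr : 0 < r) :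
    cmhz ((k 0, x 0, a 0) :: KK r k x a) + ∑ i ∈ Finset.range (r + 1),
      (uc (k 0, x 0, a 0) * (((KK r k x a).take i).map uc).prod) *
      (cmhz ((((KK r k x a).take i).map rf).reverse ++ [rf (k 0, x 0, a 0)]) * cmhz ((KK r k x a).drop i)) =
    (∑ j : Fin r, ∑ i ∈ Finset.range (k (j.val + 1)), (-X * Lh X i (a (j.val + 1))) *
      ∑ m ∈ Finset.finsuppAntidiag ((Finset.range (r + 1)).erase (j.val + 1)) (k (j.val + 1) - 1 - i),
      ((((-1) ^ k 0 * (Nat.choose (m 0 + k 0 - 1) (k 0 - 1) : ℂ)) *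
      (∏ t : Fin j.val, ((-1) ^ k (j.val - t.val) * (Nat.choose (m (j.val - t.val) + k (j.val - t.val) - 1) (k (j.val - t.val) - 1) : ℂ))) *
      (∏ t : Fin (r - (j.val + 1)), ((-1) ^ m (j.val + 2 + t.val) * (Nat.choose (m (j.val + 2 + t.val) + k (j.val + 2 + t.val) - 1) (k (j.val + 2 + t.val) - 1) : ℂ)))) *
      (cmhz ((List.ofFn fun t : Fin j.val => (k (j.val - t.val) + m (j.val - t.val), (x (j.val - t.val))⁻¹, 1 + a (j.val + 1) - a (j.val - t.val))) ++
        [(k 0 + m 0, (x 0)⁻¹, 1 + a (j.val + 1) - a 0)]) *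
       cmhz (List.ofFn fun t : Fin (r - (j.val + 1)) => (k (j.val + 2 + t.val) + m (j.val + 2 + t.val), x (j.val + 2 + t.val), 1 - a (j.val + 1) + a (j.val + 2 + t.val))))))
    + ∑ i ∈ Finset.range (k 0), (-X * Lh X i (a 0)) *
      ∑ m ∈ Finset.finsuppAntidiag ((Finset.range (r + 1)).erase 0) (k 0 - 1 - i),
      ((∏ l : Fin r, (-1) ^ m (l.val + 1) * (Nat.choose (m (l.val + 1) + k (l.val + 1) - 1) (k (l.val + 1) - 1) : ℂ)) *
      cmhz (List.ofFn fun l : Fin r => (k (l.val + 1) + m (l.val + 1), x (l.val + 1), 1 - a 0 + a (l.val + 1)))) := by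
  have hgood : ∀ i, i ≤ r → Good (k i, x i, a i) := fun i hi => ⟨H.hk i hi, H.hx i hi, fun n _ h => H.ha i hi (1 - n) (by
    simp only at h; push_cast; linear_combination h)⟩
  have hgood' : ∀ i, i ≤ r → Good (rf (k i, x i, a i)) := fun i hi => ⟨H.hk i hi, by simp [rf, H.hx i hi], fun n _ h => H.ha i hi n (by
    simp only [rf] at h; linear_combination -h)⟩
  obtain ⟨E, hE1, hE2⟩ := claimA (k 0, x 0, a 0) (KK r k x a) (by
      rw [← KK_cons]
      apply adm_ofFn
      · intro t; exact hgood _ (by omega)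
      · intro _; exact H.hr) (by
      intro h
      have := congrArg List.length h
      simp [KK] at this; omega) (by
      intro c hc
      rw [← KK_cons, List.mem_ofFn] at hc
      obtain ⟨t, rfl⟩ := hc
      exact hgood' _ (by omega)) H.h0
  have hlen : (KK r k x a).length = r := by simp [KK]
  rw [hlen] at hE2
  have hE3 : ∀ N, E N = _ := fun N => tendsto_nhds_unique (hE1 N) (by
    have := claimB H N
    simp only [SS] at this
    rw [KK, List.map_ofFn]
    exact this)
  have hE4 : E = _ := funext hE3
  rw [hE4] at hE2
  refine hE2.unique ?_
  simp only [Finset.sum_range_succ' _ r, Finset.sum_range _ (n := r)]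
  apply CesL.add
  · apply CesL.sum
    intro j _
    apply CesL.sum
    intro i _
    apply CesL.const_mul
    apply CesL.sum
    intro m _
    exact cesQ_succ H m j.val (r - (j.val + 1)) (by omega)
  · apply CesL.sum
    intro i _
    apply CesL.const_mul
    apply CesL.sum
    intro m _
    exact cesQ_zero H m

end

/-- Symmetry theorem for cyclotomic multiple Hurwitz zeta values (Theorem 2 / `mainthm-CMHZVs`). -/
theorem symmetry_cmhz (r : ℕ) (k : ℕ → ℕ) (x : ℕ → ℂ) (a : ℕ → ℂ)
    (hk : ∀ i, i ≤ r → 0 < k i)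
    (ha : ∀ i, i ≤ r → ∀ z : ℤ, a i ≠ (z : ℂ))
    (hij : ∀ i j, i < j → j ≤ r → ∀ t : ℕ, a j - a i ≠ -((t : ℂ) + 1))
    (hx : ∀ i, i ≤ r → IsRootOfUnity (x i))
    (h0 : ¬(k 0 = 1 ∧ x 0 = 1)) (hr : ¬(k r = 1 ∧ x r = 1))
    (X : ℂ) (hX : X = ∏ i ∈ Finset.range (r + 1), x i) (hX1 : X ≠ 1) :
    X⁻¹ * cmhz (List.ofFn fun i : Fin (r + 1) => (k i.val, x i.val, a i.val))
    + (∑ j : Fin (r + 1), (-1 : ℂ) ^ (∑ i ∈ Finset.range (j.val + 1), k i)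
        * (∏ i ∈ Finset.Icc (j.val + 1) r, x i)⁻¹
        * cmhz (List.ofFn fun t : Fin (r - j.val) =>
            (k (j.val + 1 + t.val), x (j.val + 1 + t.val), a (j.val + 1 + t.val)))
        * cmhz (List.ofFn fun t : Fin (j.val + 1) =>
            (k (j.val - t.val), (x (j.val - t.val))⁻¹, 1 - a (j.val - t.val))))
    + (∑ j ∈ Finset.range (k 0), ∑ m ∈ Finset.Nat.antidiagonalTuple r (k 0 - 1 - j),
        ((-1 : ℂ) ^ (k 0 - 1 - j)
            * ∏ l : Fin r, (Nat.choose (m l + k (l.val + 1) - 1) (k (l.val + 1) - 1) : ℂ))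
          * ((-1 : ℂ) ^ j * lih1 (j + 1) X⁻¹ (1 - a 0) - X⁻¹ * lih1 (j + 1) X (a 0))
          * cmhz (List.ofFn fun l : Fin r =>
              (k (l.val + 1) + m l, x (l.val + 1), 1 - a 0 + a (l.val + 1))))
    + (∑ j : Fin r, ∑ i ∈ Finset.range (k (j.val + 1)),
        ∑ m ∈ Finset.range (k (j.val + 1) - i),
        ∑ mm ∈ (Finset.Nat.antidiagonalTuple r m).filter (fun mm => mm j = 0),
          (-1 : ℂ) ^ ((∑ t ∈ Finset.range (j.val + 1), k t)
              + ∑ l ∈ Finset.univ.filter (fun l => j < l), mm l)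
          * (Nat.choose (k 0 + k (j.val + 1) - m - i - 2) (k 0 - 1) : ℂ)
          * (∏ l ∈ Finset.univ.erase j,
              (Nat.choose (mm l + k (l.val + 1) - 1) (k (l.val + 1) - 1) : ℂ))
          * ((-1 : ℂ) ^ i * lih1 (i + 1) X⁻¹ (1 - a (j.val + 1))
              - X⁻¹ * lih1 (i + 1) X (a (j.val + 1)))
          * cmhz (List.ofFn fun t : Fin (r - (j.val + 1)) =>
              (k (j.val + 2 + t.val) + mm ⟨j.val + 1 + t.val, by have := t.isLt; omega⟩,
                x (j.val + 2 + t.val), 1 - a (j.val + 1) + a (j.val + 2 + t.val)))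
          * cmhz ((List.ofFn fun t : Fin j.val =>
              (k (j.val - t.val) + mm ⟨j.val - 1 - t.val, by have := t.isLt; have := j.isLt; omega⟩,
                (x (j.val - t.val))⁻¹, 1 + a (j.val + 1) - a (j.val - t.val)))
              ++ [(k 0 + k (j.val + 1) - i - m - 1, (x 0)⁻¹, 1 + a (j.val + 1) - a 0)]))
    = 0 := by
  have hx' : ∀ i, i ≤ r → ‖x i‖ = 1 := by
    intro i hi
    obtain ⟨N, hN, h⟩ := hx i hi
    exact Complex.norm_eq_one_of_pow_eq_one h hN.ne'
  have H : Hyp r k x a X := ⟨hk, ha, hij, hx', h0, hr, hX, hX1⟩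
  rcases Nat.eq_zero_or_pos r with rfl | hr0
  · have hXx : X = x 0 := by rw [hX]; simp
    have hs := sym_zero (k 0) (hk 0 le_rfl) (x 0) (a 0)
    rw [Finset.sum_eq_single_of_mem (k 0 - 1) (Finset.mem_range.2 (by have := hk 0 le_rfl; omega))]
    · rw [Nat.sub_self, hXx]
      simp [cmhz_nil]
      exact hs
    · intro b hb hne
      rw [Finset.mem_range] at hb
      obtain ⟨n, hn⟩ : ∃ n, k 0 - 1 - b = n + 1 := ⟨k 0 - 1 - b - 1, by omega⟩
      rw [hn, Finset.Nat.antidiagonalTuple_zero_succ, Finset.sum_empty]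
  have hid := identity H hr0
  have hX0 := H.hX0
  set A4 := (∑ j : Fin r, ∑ i ∈ Finset.range (k (j.val + 1)), (-X * Lh X i (a (j.val + 1))) *
      ∑ m ∈ Finset.finsuppAntidiag ((Finset.range (r + 1)).erase (j.val + 1)) (k (j.val + 1) - 1 - i),
      ((((-1) ^ k 0 * (Nat.choose (m 0 + k 0 - 1) (k 0 - 1) : ℂ)) *
      (∏ t : Fin j.val, ((-1) ^ k (j.val - t.val) * (Nat.choose (m (j.val - t.val) + k (j.val - t.val) - 1) (k (j.val - t.val) - 1) : ℂ))) *
      (∏ t : Fin (r - (j.val + 1)), ((-1) ^ m (j.val + 2 + t.val) * (Nat.choose (m (j.val + 2 + t.val) + k (j.val + 2 + t.val) - 1) (k (j.val + 2 + t.val) - 1) : ℂ)))) *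
      (cmhz ((List.ofFn fun t : Fin j.val => (k (j.val - t.val) + m (j.val - t.val), (x (j.val - t.val))⁻¹, 1 + a (j.val + 1) - a (j.val - t.val))) ++
        [(k 0 + m 0, (x 0)⁻¹, 1 + a (j.val + 1) - a 0)]) *
       cmhz (List.ofFn fun t : Fin (r - (j.val + 1)) => (k (j.val + 2 + t.val) + m (j.val + 2 + t.val), x (j.val + 2 + t.val), 1 - a (j.val + 1) + a (j.val + 2 + t.val)))))) with hA4
  set A3 := ∑ i ∈ Finset.range (k 0), (-X * Lh X i (a 0)) *
      ∑ m ∈ Finset.finsuppAntidiag ((Finset.range (r + 1)).erase 0) (k 0 - 1 - i),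
      ((∏ l : Fin r, (-1) ^ m (l.val + 1) * (Nat.choose (m (l.val + 1) + k (l.val + 1) - 1) (k (l.val + 1) - 1) : ℂ)) *
      cmhz (List.ofFn fun l : Fin r => (k (l.val + 1) + m (l.val + 1), x (l.val + 1), 1 - a 0 + a (l.val + 1)))) with hA3
  set A2 := ∑ i ∈ Finset.range (r + 1),
      (uc (k 0, x 0, a 0) * (((KK r k x a).take i).map uc).prod) *
      (cmhz ((((KK r k x a).take i).map rf).reverse ++ [rf (k 0, x 0, a 0)]) * cmhz ((KK r k x a).drop i)) with hA2
  rw [KK_cons]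
  suffices h : ∀ c B2 B3 B4 : ℂ, B2 = X⁻¹ * A2 → B3 = -X⁻¹ * A3 → B4 = -X⁻¹ * A4 → c + A2 = A4 + A3 →
      X⁻¹ * c + B2 + B3 + B4 = 0 by
    refine h _ _ _ _ ?_ ?_ ?_ hid
    · rw [hA2, Finset.sum_range, Finset.mul_sum]
      refine Finset.sum_congr rfl fun j _ => ?_
      have hj : j.val ≤ r := by omega
      rw [KK_prod _ _ _ _ _ hj, KK_take _ _ _ _ _ hj, KK_drop]
      have e : X = (∏ i ∈ Finset.range (j.val + 1), x i) * ∏ i ∈ Finset.Icc (j.val + 1) r, x i := by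
        rw [hX, ← Finset.prod_range_mul_prod_Ico x (by omega : j.val + 1 ≤ r + 1)]
        rfl
      have e1 : (∏ i ∈ Finset.range (j.val + 1), x i) ≠ 0 := by
        intro h; rw [h, zero_mul] at e; exact hX0 e
      have e2 : X⁻¹ * (∏ i ∈ Finset.range (j.val + 1), x i) = (∏ i ∈ Finset.Icc (j.val + 1) r, x i)⁻¹ := by
        rw [e, mul_inv]; field_simp
      rw [← e2]
      ring
    · rw [hA3, Finset.mul_sum]
      refine Finset.sum_congr rfl fun i _ => ?_
      rw [reindex0, ← mul_assoc, Finset.mul_sum]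
      refine Finset.sum_congr rfl fun g hg => ?_
      rw [Finset.Nat.mem_antidiagonalTuple] at hg
      have e : ∀ l : Fin r, ext0 0 g (l.val + 1) = g l := fun l => ext0_succ _ _ _ l.isLt
      simp only [e]
      rw [Finset.prod_mul_distrib, Finset.prod_pow_eq_pow_sum, hg]
      have e2 : -X⁻¹ * (-X * Lh X i (a 0)) = Lh X i (a 0) := by field_simp
      rw [e2, Lh]
      ring
    · rw [hA4, Finset.mul_sum]
      refine Finset.sum_congr rfl fun j _ => ?_
      rw [Finset.mul_sum]
      refine Finset.sum_congr rfl fun i hi => ?_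
      rw [Finset.mem_range] at hi
      have hk0 := hk 0 (by omega)
      rw [reindexS, ← mul_assoc, Finset.mul_sum]
      rw [show k (j.val + 1) - 1 - i + 1 = k (j.val + 1) - i by omega]
      refine Finset.sum_congr rfl fun m hm => ?_
      rw [Finset.mem_range] at hm
      rw [Finset.mul_sum]
      refine Finset.sum_congr rfl fun g _ => ?_
      have e2 : -X⁻¹ * (-X * Lh X i (a (j.val + 1))) = Lh X i (a (j.val + 1)) := by field_simp
      set v := k (j.val + 1) - 1 - i - m with hv
      have hjr := j.isLt
      rw [e2, ext0_zero, show v + k 0 - 1 = k 0 + k (j.val + 1) - m - i - 2 by omega,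
        show k 0 + v = k 0 + k (j.val + 1) - i - m - 1 by omega]
      have f1 : ∀ t : Fin j.val, ext0 v g (j.val - t.val) = g ⟨j.val - 1 - t.val, by omega⟩ := by
        intro t
        rw [← ext0_succ v g]
        congr 1; omega
      have f2 : ∀ t : Fin (r - (j.val + 1)), ext0 v g (j.val + 2 + t.val) = g ⟨j.val + 1 + t.val, by omega⟩ := by
        intro t
        rw [← ext0_succ v g]
        congr 1; omega
      have g1 := prod_erase_fin r j.val (r - (j.val + 1)) (by omega) j rfl
        (fun l => (Nat.choose (ext0 v g (l + 1) + k (l + 1) - 1) (k (l + 1) - 1) : ℂ))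
      have g2 := sum_filter_fin r j.val (r - (j.val + 1)) (by omega) j rfl (fun l => ext0 v g (l + 1))
      have f3 : ∀ l : Fin r, ext0 v g (l.val + 1) = g l := fun l => ext0_succ _ _ _ l.isLt
      simp only [f3] at g1 g2
      have f4 : ∀ t : Fin j.val, j.val - 1 - t.val + 1 = j.val - t.val := by intro t; omega
      have f5 : ∀ t : Fin (r - (j.val + 1)), j.val + 1 + t.val + 1 = j.val + 2 + t.val := by intro t; omega
      simp only [f4, f5] at g1 g2
      rw [g1, g2]
      have g3 : (-1 : ℂ) ^ (∑ t ∈ Finset.range (j.val + 1), k t) = (-1) ^ k 0 * ∏ t : Fin j.val, (-1 : ℂ) ^ k (j.val - t.val) := by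
        rw [Finset.sum_range_succ', pow_add, mul_comm, ← Finset.prod_pow_eq_pow_sum, ← Finset.prod_range_reflect,
          Finset.prod_range]
        simp only [f4]
      rw [pow_add, g3, ← Finset.prod_pow_eq_pow_sum, Finset.prod_mul_distrib, Finset.prod_mul_distrib]
      simp only [f1, f2]
      rw [Lh]
      ring
  intro c B2 B3 B4 e2 e3 e4 e
  rw [e2, e3, e4]
  linear_combination X⁻¹ * e
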